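/- Let $d,k\ge 1$. Let $f:\mathbb R^d\to\mathbb R$ be four times continuously differentiable with a unique global minimizer $x^\star$, positive-definite Hessian $H:=H_f(x^\star)$, $\int_{\mathbb R^d} e^{-f(x)}\,dx<\infty$ and $\liminf_{\|x\|\to\infty} f(x)>f(x^\star)$. For $\alpha>0$ put $Z_\alpha:=\int e^{-\alpha f(x)}\,dx$, let $\pi_\alpha$ be the probability measure with density $e^{-\alpha f}/Z_\alpha$, write $\pi_\alpha(\varphi):=\int\varphi\,d\pi_\alpha$, and put $m_\alpha:=\sqrt{\det H}\,(\alpha/2\pi)^{d/2}$. For a twice continuously differentiable $\psi:\mathbb R^d\to\mathbb R$ put $$C_{f,\psi}:=\Bigl|\operatorname{Tr}\bigl(H^{-1}H_\psi(x^\star)\bigr)-\bigl\langle\nabla\psi(x^\star),\,H^{-1}\,\mathrm{PTr}(D^3f(x^\star))\bigr\rangle\Bigr|,\qquad \mathrm{PTr}(D^3f(x^\star))_i:=\sum_{j,l=1}^d (H^{-1})_{jl}\,\partial_i\partial_j\partial_l f(x^\star).$$ Let $\varphi:\mathbb R^d\to\mathbb R^k$ be measurable, $\bar\varphi:=\varphi-\varphi(x^\star)$,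 and let $g_0:\mathbb R^d\to(0,\infty)$ be such that: for some $c_0>0$, $e^{-(f(y)-f(x^\star))}\le c_0\,g_0(y)$ for all $y$; $\int e^{-(f(y)-f(x^\star))}\|\varphi(y)\|^2\,dy<\infty$; and the functions $\|\varphi\|^2/g_0$, $\|\bar\varphi\|^2/g_0$, $1/g_0$ are twice continuously differentiable with $C_{f,\|\varphi\|^2/g_0}>0$, $C_{f,\|\bar\varphi\|^2/g_0}>0$, $C_{f,1/g_0}>0$. Then there exist constants $C_1>0$ and $\tilde\alpha_1>1$, depending only on $g_0,f,\varphi$, such that the following holds. Let $\mathcal Q$ be any family of probability densities on $\mathbb R^d$ with $g_0\le q$ pointwise for every $q\in\mathcal Q$ and $\sup_{q\in\mathcal Q}\int\|\varphi(y)\|^4q(y)\,dy<\infty$. On a probability space with a filtration $(\mathcal F_i)_{i\ge0}$, let $X^i$ ($i\ge1$) be $\mathcal F_i$-measurable random vectors in $\mathbb R^d$, where $X^1$ has a density $q_0\in\mathcal Q$ and, for each $i\ge1$, the conditional distribution of $X^{i+1}$ given $\mathcal F_i$ has an $\mathcal F_i$-measurable random density $q_i$ that belongs almost surely to $\mathcal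 Q$. For $\alpha>0$ and $n\ge 1$ put $$w^i:=\frac{e^{-\alpha f(X^i)}}{q_{i-1}(X^i)},\qquad \tilde\pi^{(A)}_{n,\alpha}(\varphi):=\frac1{nZ_\alpha}\sum_{i=1}^n w^i\varphi(X^i).$$ Then for every $\alpha>\tilde\alpha_1$ and every $n\ge1$, $\varphi$ is $\pi_\alpha$-integrable and $$\mathbb E\bigl\|\tilde\pi^{(A)}_{n,\alpha}(\varphi)-\pi_\alpha(\varphi)\bigr\|^2\le n^{-1}\,2^{-d/2}\,m_\alpha\Bigl(\frac{\|\varphi(x^\star)\|^2}{g_0(x^\star)}+\frac{C_{f,\|\varphi\|^2/g_0}}{2\alpha}\Bigr)\Bigl(1+\frac{C_1}{\alpha}\Bigr).$$ -/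

import Mathlib

open MeasureTheory ProbabilityTheory

noncomputable section

namespace LISO

/-- `ℝ^d` with its Euclidean norm. -/
abbrev E (d : ℕ) := EuclideanSpace ℝ (Fin d)

/-- The `i`-th standard basis vector of `ℝ^d`. -/
def bvec (d : ℕ) (i : Fin d) : E d := EuclideanSpace.single i 1

/-- The gradient of `f` at `x`, in coordinates. -/
def grad {d : ℕ} (f : E d → ℝ) (x : E d) (i : Fin d) : ℝ := fderiv ℝ f x (bvec d i)

/-- The Hessian matrix of `f` at `x`. -/
def hess {d : ℕ} (f : E d → ℝ) (x : E d) : Matrix (Fin d) (Fin d) ℝ :=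
  Matrix.of fun i j => iteratedFDeriv ℝ 2 f x ![bvec d i, bvec d j]

/-- The partial trace of `D³f(x)` with respect to the metric `H_f(x)`:
`PTr(D³f(x))_i = ∑_{j,k} (H_f(x)⁻¹)_{jk} ∂_i∂_j∂_k f(x)`.
For `H_f(x) = I` this is `∑_k ∂_i∂_k∂_k f(x)`. -/
def ptr3 {d : ℕ} (f : E d → ℝ) (x : E d) (i : Fin d) : ℝ :=
  ∑ j, ∑ k, (hess f x)⁻¹ j k * iteratedFDeriv ℝ 3 f x ![bvec d i, bvec d j, bvec d k]

/-- The Laplace constant `C_{f,ψ} = |Tr(H_f⁻¹ H_ψ) - ⟨∇ψ, H_f⁻¹ PTr(D³f)⟩|` at `x`,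
for a scalar function `ψ`. -/
def laplaceConst {d : ℕ} (f : E d → ℝ) (x : E d) (ψ : E d → ℝ) : ℝ :=
  |((hess f x)⁻¹ * hess ψ x).trace - grad ψ x ⬝ᵥ Matrix.mulVec (hess f x)⁻¹ (ptr3 f x)|

/-- `m_α = √(det H_f(x)) · (α/(2π))^{d/2}`. -/
def mconst {d : ℕ} (f : E d → ℝ) (x : E d) (α : ℝ) : ℝ :=
  Real.sqrt (hess f x).det * (α / (2 * Real.pi)) ^ ((d : ℝ) / 2)

/-- The normalizing constant `Z_α = ∫ exp(-α f)`. -/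
def Zc {d : ℕ} (f : E d → ℝ) (α : ℝ) : ℝ := ∫ x, Real.exp (-α * f x)

/-- The Gibbs measure `π_α`, with density `exp(-α f) / Z_α`. -/
def gibbs {d : ℕ} (f : E d → ℝ) (α : ℝ) : Measure (E d) :=
  volume.withDensity fun x => ENNReal.ofReal (Real.exp (-α * f x) / Zc f α)

/-- `p` is a probability density on `ℝ^d`. -/
def IsDensity {d : ℕ} (p : E d → ℝ) : Prop :=
  Measurable p ∧ (∀ x, 0 ≤ p x) ∧ ∫⁻ x, ENNReal.ofReal (p x) = 1

/-- Adaptive sampling: `X 1, X 2, …` are the particles (`X 0` plays no role), and `q i` is the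
random density from which `X (i + 1)` is drawn; `q 0` is deterministic. -/
structure IsAdaptiveSampling {d : ℕ} {Ω : Type*} {mΩ : MeasurableSpace Ω} (P : Measure Ω)
    (F : Filtration ℕ mΩ) (𝒬 : Set (E d → ℝ)) (X : ℕ → Ω → E d) (q : ℕ → Ω → E d → ℝ)
    (q₀ : E d → ℝ) : Prop where
  /-- The initial density belongs to the family. -/
  init_mem : q₀ ∈ 𝒬
  init_eq : ∀ ω, q 0 ω = q₀
  /-- The particle `X^{i+1}` is `F_{i+1}`-measurable. -/
  adapted : ∀ i, Measurable[F (i + 1)] (X (i + 1))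
  /-- The first particle has density `q₀`. -/
  law_one : P.map (X 1) = volume.withDensity fun x => ENNReal.ofReal (q₀ x)
  /-- For `i ≥ 1`, `q_i` is an `F_i`-measurable random function. -/
  density_measurable : ∀ i, 1 ≤ i →
    @Measurable (Ω × E d) ℝ ((F i).prod inferInstance) _ (Function.uncurry (q i))
  density_mem : ∀ i, 1 ≤ i → ∀ᵐ ω ∂P, q i ω ∈ 𝒬
  /-- For `i ≥ 1`, the conditional distribution of `X^{i+1}` given `F_i` has density `q_i`. -/
  cond_law : ∀ i, 1 ≤ i → ∀ s : Set (E d), MeasurableSet s →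
    P[(X (i + 1) ⁻¹' s).indicator (fun _ => (1 : ℝ)) | F i] =ᵐ[P] fun ω => ∫ x in s, q i ω x

/-- The adaptive unnormalized estimator
`(1/(n Z_α)) ∑_{i=1}^n w^i φ(X^i)`, with `w^i = exp(-α f(X^i)) / q_{i-1}(X^i)`. -/
def estimator {d k : ℕ} {Ω : Type*} (f : E d → ℝ) (α : ℝ) (φ : E d → E k) (n : ℕ)
    (X : ℕ → Ω → E d) (q : ℕ → Ω → E d → ℝ) (ω : Ω) : E k :=
  (1 / ((n : ℝ) * Zc f α)) • ∑ i ∈ Finset.range n,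
    (Real.exp (-α * f (X (i + 1) ω)) / q i ω (X (i + 1) ω)) • φ (X (i + 1) ω)

end LISO

end

namespace LISO

section Taylor

variable {V : Type*} [NormedAddCommGroup V] [NormedSpace ℝ V]

/-- The Taylor polynomial of degree `n` of `f` at `x`, evaluated at `x + y`. -/
noncomputable def taylorSum (n : ℕ) (f : V → ℝ) (x y : V) : ℝ :=
  ∑ k ∈ Finset.range (n + 1), ((k.factorial : ℝ)⁻¹ • iteratedFDeriv ℝ k f x fun _ => y)

theorem abs_iteratedFDeriv_apply_const_le (n : ℕ) (f : V → ℝ) (x y : V) :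
    |iteratedFDeriv ℝ n f x fun _ => y| ≤ ‖iteratedFDeriv ℝ n f x‖ * ‖y‖ ^ n := by
  have := (iteratedFDeriv ℝ n f x).le_opNorm fun _ => y
  simpa using this

/-- Taylor's theorem with a remainder of order `n + 1`, uniformly on balls. -/
theorem exists_taylor_bound [FiniteDimensional ℝ V] {f : V → ℝ} {n : ℕ}
    (hf : ContDiff ℝ (n + 1) f) (x : V) (R : ℝ) :
    ∃ K > 0, ∀ y, ‖y‖ ≤ R → |f (x + y) - taylorSum n f x y| ≤ K * ‖y‖ ^ (n + 1) := by
  have hc : Continuous (iteratedFDeriv ℝ (n + 1) f) := hf.continuous_iteratedFDeriv (by simp)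
  obtain ⟨K, hK⟩ := (isCompact_closedBall x R).exists_bound_of_continuousOn hc.continuousOn
  refine ⟨|K| + 1, by positivity, fun y hy => ?_⟩
  rw [map_add_eq_sum_add_integral_iteratedFDeriv (n := n) fun t _ => hf.contDiffAt, taylorSum,
    add_sub_cancel_left, smul_eq_mul, abs_mul]
  have h1 : |((n.factorial : ℝ)⁻¹)| ≤ 1 := by
    rw [abs_of_nonneg (by positivity)]
    exact inv_le_one_of_one_le₀ (by exact_mod_cast n.factorial_pos)
  have h2 : ‖∫ t in (0:ℝ)..1, (1 - t) ^ n • iteratedFDeriv ℝ (n + 1) f (x + t • y) fun _ => y‖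
      ≤ (|K| + 1) * ‖y‖ ^ (n + 1) * |(1:ℝ) - 0| := by
    refine intervalIntegral.norm_integral_le_of_norm_le_const fun t ht => ?_
    rw [Set.uIoc_of_le zero_le_one] at ht
    have h3 : ‖iteratedFDeriv ℝ (n + 1) f (x + t • y)‖ ≤ K := by
      refine hK _ ?_
      rw [Metric.mem_closedBall, dist_eq_norm, add_sub_cancel_left, norm_smul, Real.norm_eq_abs,
        abs_of_pos ht.1]
      nlinarith [ht.1, ht.2, norm_nonneg y]
    rw [norm_smul, Real.norm_eq_abs, Real.norm_eq_abs]
    have h4 : |(1 - t) ^ n| ≤ 1 := by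
      rw [abs_pow, abs_of_nonneg (by linarith [ht.2])]
      exact pow_le_one₀ (by linarith [ht.2]) (by linarith [ht.1])
    calc _ ≤ 1 * (K * ‖y‖ ^ (n + 1)) := by
            refine mul_le_mul h4 ?_ (abs_nonneg _) zero_le_one
            exact (abs_iteratedFDeriv_apply_const_le _ _ _ _).trans (by gcongr)
      _ ≤ _ := by
            rw [one_mul]; gcongr; linarith [le_abs_self K]
  rw [sub_zero, abs_one, mul_one, Real.norm_eq_abs] at h2
  calc _ ≤ 1 * ((|K| + 1) * ‖y‖ ^ (n + 1)) := mul_le_mul h1 h2 (abs_nonneg _) zero_le_one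
    _ = _ := one_mul _

/-- Taylor's theorem of order two with a remainder in Peano form. -/
theorem exists_taylor_two_peano {f : V → ℝ} (hf : ContDiff ℝ 2 f) (x : V) {ε : ℝ} (hε : 0 < ε) :
    ∃ r > 0, ∀ y, ‖y‖ ≤ r → |f (x + y) - taylorSum 2 f x y| ≤ ε * ‖y‖ ^ 2 := by
  have hc : Continuous (iteratedFDeriv ℝ 2 f) := hf.continuous_iteratedFDeriv (by simp)
  obtain ⟨r, hr, hball⟩ := Metric.continuousAt_iff.1 (hc.continuousAt (x := x)) ε hε
  refine ⟨r / 2, by positivity, fun y hy => ?_⟩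
  have hT : taylorSum 2 f x y = taylorSum 1 f x y +
      ∫ t in (0:ℝ)..1, (1 - t) * iteratedFDeriv ℝ 2 f x fun _ => y := by
    rw [taylorSum, Finset.sum_range_succ, intervalIntegral.integral_mul_const]
    simp only [taylorSum, Nat.reduceAdd, smul_eq_mul, add_right_inj]
    rw [intervalIntegral.integral_sub (by simp) (by simp)]
    norm_num [Nat.factorial]
  rw [map_add_eq_sum_add_integral_iteratedFDeriv (n := 1) fun t _ => hf.contDiffAt, hT, taylorSum,
    add_sub_add_left_eq_sub]
  simp only [Nat.factorial_one, Nat.cast_one, inv_one, one_mul, pow_one, smul_eq_mul, Nat.reduceAdd]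
  rw [← intervalIntegral.integral_sub]
  · have h2 : ‖∫ t in (0:ℝ)..1, ((1 - t) * (iteratedFDeriv ℝ 2 f (x + t • y) fun _ => y) -
        (1 - t) * iteratedFDeriv ℝ 2 f x fun _ => y)‖ ≤ ε * ‖y‖ ^ 2 * |(1:ℝ) - 0| := by
      refine intervalIntegral.norm_integral_le_of_norm_le_const fun t ht => ?_
      rw [Set.uIoc_of_le zero_le_one] at ht
      have h3 : ‖iteratedFDeriv ℝ 2 f (x + t • y) - iteratedFDeriv ℝ 2 f x‖ ≤ ε := by
        rw [← dist_eq_norm]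
        refine (hball ?_).le
        rw [dist_eq_norm, add_sub_cancel_left, norm_smul, Real.norm_eq_abs, abs_of_pos ht.1]
        nlinarith [ht.1, ht.2, norm_nonneg y]
      rw [← mul_sub, ← sub_apply, norm_mul, Real.norm_eq_abs,
        abs_of_nonneg (by linarith [ht.2])]
      calc _ ≤ 1 * (ε * ‖y‖ ^ 2) := by
            refine mul_le_mul (by linarith [ht.1]) ?_ (norm_nonneg _) zero_le_one
            refine (ContinuousMultilinearMap.le_opNorm _ _).trans ?_
            simp only [Finset.prod_const, Finset.card_univ, Fintype.card_fin]
            gcongr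
        _ = _ := one_mul _
    simpa using h2
  · apply Continuous.intervalIntegrable
    have : Continuous fun t : ℝ => iteratedFDeriv ℝ 2 f (x + t • y) := hc.comp (by fun_prop)
    have := this.eval_const (fun _ => y)
    fun_prop
  · exact Continuous.intervalIntegrable (by fun_prop) _ _

end Taylor

section Gaussian

theorem integrable_exp_neg_mul_sq_norm {d : ℕ} {b : ℝ} (hb : 0 < b) :
    Integrable fun z : E d => Real.exp (-b * ‖z‖ ^ 2) := by
  have h := GaussianFourier.integrable_cexp_neg_mul_sq_norm_add (V := E d) (b := (b : ℂ))
    (by simpa using hb) 0 0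
  have h2 := h.norm
  refine h2.congr (Filter.Eventually.of_forall fun z => ?_)
  simp only [inner_zero_left, Complex.ofReal_zero, mul_zero, add_zero, Complex.norm_exp]
  congr 1
  norm_cast

theorem integral_exp_neg_mul_sq_norm {d : ℕ} {b : ℝ} (hb : 0 < b) :
    ∫ z : E d, Real.exp (-b * ‖z‖ ^ 2) = (Real.pi / b) ^ ((d : ℝ) / 2) := by
  simpa using GaussianFourier.integral_rexp_neg_mul_sq_norm (V := E d) hb

theorem integrable_sq_mul_exp_neg_mul_sq {b : ℝ} (hb : 0 < b) :
    Integrable fun x : ℝ => x ^ 2 * Real.exp (-b * x ^ 2) := by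
  simpa using integrable_rpow_mul_exp_neg_mul_sq hb (s := 2) (by norm_num)

theorem integral_sq_mul_exp_neg_mul_sq {b : ℝ} (hb : 0 < b) :
    ∫ x : ℝ, x ^ 2 * Real.exp (-b * x ^ 2) = √(Real.pi / b) / (2 * b) := by
  have hderiv : ∀ x : ℝ, HasDerivAt (fun x : ℝ => x * Real.exp (-b * x ^ 2))
      (Real.exp (-b * x ^ 2) - 2 * b * (x ^ 2 * Real.exp (-b * x ^ 2))) x := by
    intro x
    have h1 : HasDerivAt (fun x : ℝ => -b * x ^ 2) (-b * (2 * x)) x := by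
      simpa using (hasDerivAt_pow 2 x).const_mul (-b)
    refine ((hasDerivAt_id' x).mul h1.exp).congr_deriv ?_
    ring
  have h0 := integral_eq_zero_of_hasDerivAt_of_integrable hderiv
    ((integrable_exp_neg_mul_sq hb).sub ((integrable_sq_mul_exp_neg_mul_sq hb).const_mul _))
    (integrable_mul_exp_neg_mul_sq hb)
  rw [integral_sub (integrable_exp_neg_mul_sq hb)
    ((integrable_sq_mul_exp_neg_mul_sq hb).const_mul _), integral_const_mul,
    integral_gaussian] at h0
  rw [eq_div_iff (by positivity)]
  linarith

theorem integral_mul_exp_neg_mul_sq_eq_zero (b : ℝ) :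
    ∫ x : ℝ, x * Real.exp (-b * x ^ 2) = 0 := by
  have h := integral_neg_eq_self (fun x : ℝ => x * Real.exp (-b * x ^ 2)) volume
  simp only [neg_sq, neg_mul, integral_neg] at h
  simp only [neg_mul]
  linarith

theorem exp_neg_mul_sq_norm_eq_prod {d : ℕ} (b : ℝ) (z : E d) :
    Real.exp (-b * ‖z‖ ^ 2) = ∏ l, Real.exp (-b * z l ^ 2) := by
  rw [← Real.exp_sum, ← Finset.mul_sum, EuclideanSpace.real_norm_sq_eq]

/-- The mixed second moments of an isotropic Gaussian. -/
theorem integral_coord_mul_coord_mul_exp {d : ℕ} {b : ℝ} (hb : 0 < b) (i j : Fin d) :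
    ∫ z : E d, z i * z j * Real.exp (-b * ‖z‖ ^ 2) =
      if i = j then (Real.pi / b) ^ ((d : ℝ) / 2) / (2 * b) else 0 := by
  let h : Fin d → ℝ → ℝ := fun l x =>
    (if l = i then x else 1) * (if l = j then x else 1) * Real.exp (-b * x ^ 2)
  have h1 : ∀ z : E d, z i * z j * Real.exp (-b * ‖z‖ ^ 2) = ∏ l, h l (z l) := by
    intro z
    simp only [h, Finset.prod_mul_distrib, exp_neg_mul_sq_norm_eq_prod]
    simp
  simp_rw [h1]
  rw [← (PiLp.volume_preserving_toLp (Fin d)).integral_comp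
    (MeasurableEquiv.toLp 2 (Fin d → ℝ)).measurableEmbedding]
  simp only
  have h2 := integral_fintype_prod_volume_eq_prod (𝕜 := ℝ) h
  rw [h2]
  split_ifs with hij
  · subst hij
    have hd : 0 < d := i.pos
    have h3 : ∀ l, ∫ x, h l x = √(Real.pi / b) * (if l = i then 1 / (2 * b) else 1) := by
      intro l
      by_cases hl : l = i
      · simp only [h, hl, if_true, ← sq, integral_sq_mul_exp_neg_mul_sq hb]
        ring
      · simp [h, hl, -neg_mul, integral_gaussian]
    simp_rw [h3, Finset.prod_mul_distrib]
    rw [Finset.prod_const, Finset.card_univ, Fintype.card_fin, Finset.prod_ite_eq' , Real.sqrt_eq_rpow,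
      ← Real.rpow_natCast, ← Real.rpow_mul (by positivity)]
    simp only [Finset.mem_univ, if_true]
    rw [mul_one_div]
    congr 2
    ring
  · refine Finset.prod_eq_zero (Finset.mem_univ i) ?_
    simp [h, hij, -neg_mul, integral_mul_exp_neg_mul_sq_eq_zero]

theorem sq_norm_mul_exp_le {d : ℕ} {b : ℝ} (hb : 0 < b) (z : E d) :
    ‖z‖ ^ 2 * Real.exp (-b * ‖z‖ ^ 2) ≤ 2 / b * Real.exp (-(b / 2) * ‖z‖ ^ 2) := by
  have h1 : b / 2 * ‖z‖ ^ 2 ≤ Real.exp (b / 2 * ‖z‖ ^ 2) := by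
    linarith [Real.add_one_le_exp (b / 2 * ‖z‖ ^ 2)]
  have h2 : Real.exp (-(b / 2) * ‖z‖ ^ 2) =
      Real.exp (b / 2 * ‖z‖ ^ 2) * Real.exp (-b * ‖z‖ ^ 2) := by
    rw [← Real.exp_add]; congr 1; ring
  rw [h2, ← mul_assoc]
  gcongr
  rw [div_mul_eq_mul_div, le_div_iff₀ hb]
  linarith

theorem integrable_coord_mul_coord_mul_exp {d : ℕ} {b : ℝ} (hb : 0 < b) (i j : Fin d) :
    Integrable fun z : E d => z i * z j * Real.exp (-b * ‖z‖ ^ 2) := by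
  refine ((integrable_exp_neg_mul_sq_norm (d := d) (half_pos hb)).const_mul (2 / b)).mono'
    (by fun_prop) (Filter.Eventually.of_forall fun z => ?_)
  refine le_trans ?_ (sq_norm_mul_exp_le hb z)
  rw [norm_mul, norm_mul, Real.norm_eq_abs (Real.exp _), Real.abs_exp, sq]
  have := PiLp.norm_apply_le z i
  have := PiLp.norm_apply_le z j
  gcongr

/-- The quadratic form of a matrix. -/
noncomputable def quadForm {d : ℕ} (M : Matrix (Fin d) (Fin d) ℝ) (z : E d) : ℝ :=
  ∑ i, ∑ j, M i j * (z i * z j)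

theorem quadForm_smul {d : ℕ} (M : Matrix (Fin d) (Fin d) ℝ) (t : ℝ) (z : E d) :
    quadForm M (t • z) = t ^ 2 * quadForm M z := by
  simp only [quadForm, Finset.mul_sum, PiLp.smul_apply, smul_eq_mul]
  refine Finset.sum_congr rfl fun i _ => Finset.sum_congr rfl fun j _ => by ring

theorem quadForm_nonneg_of_ball {d : ℕ} {M : Matrix (Fin d) (Fin d) ℝ} {r : ℝ} (hr : 0 < r)
    (h : ∀ z, ‖z‖ ≤ r → 0 ≤ quadForm M z) (z : E d) : 0 ≤ quadForm M z := by
  have hz0 : 0 < r / (‖z‖ + 1) := by positivity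
  have h1 := h ((r / (‖z‖ + 1)) • z) (by
    rw [norm_smul, Real.norm_eq_abs, abs_of_pos hz0, div_mul_eq_mul_div, div_le_iff₀ (by positivity)]
    gcongr; linarith)
  rw [quadForm_smul] at h1
  exact nonneg_of_mul_nonneg_right h1 (by positivity)

theorem trace_nonneg_of_quadForm_nonneg {d : ℕ} {M : Matrix (Fin d) (Fin d) ℝ}
    (h : ∀ z, 0 ≤ quadForm M z) : 0 ≤ M.trace := by
  refine Finset.sum_nonneg fun i _ => ?_
  simpa [quadForm, EuclideanSpace.single, Pi.single_apply] using h (EuclideanSpace.single i 1)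

theorem quadForm_add_smul_one {d : ℕ} (M : Matrix (Fin d) (Fin d) ℝ) (ε : ℝ) (z : E d) :
    quadForm (M + ε • 1) z = quadForm M z + ε * ‖z‖ ^ 2 := by
  simp only [quadForm, Matrix.add_apply, Matrix.smul_apply, Matrix.one_apply, add_mul,
    Finset.sum_add_distrib, EuclideanSpace.real_norm_sq_eq, Finset.mul_sum, smul_eq_mul]
  simp [sq]

/-- The integral of a quadratic form against an isotropic Gaussian. -/
theorem integral_quadForm_mul_exp {d : ℕ} {b : ℝ} (hb : 0 < b) (M : Matrix (Fin d) (Fin d) ℝ) :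
    Integrable (fun z : E d => quadForm M z * Real.exp (-b * ‖z‖ ^ 2)) ∧
    ∫ z : E d, quadForm M z * Real.exp (-b * ‖z‖ ^ 2) =
      (Real.pi / b) ^ ((d : ℝ) / 2) / (2 * b) * M.trace := by
  simp only [quadForm, Finset.sum_mul, mul_assoc (M _ _)]
  have hint := fun i j => (integrable_coord_mul_coord_mul_exp (d := d) hb i j).const_mul (M i j)
  refine ⟨integrable_finsetSum _ fun i _ => integrable_finsetSum _ fun j _ => hint i j, ?_⟩
  rw [integral_finsetSum _ fun i _ => integrable_finsetSum _ fun j _ => hint i j]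
  simp_rw [integral_finsetSum _ fun j _ => hint _ j, integral_const_mul,
    integral_coord_mul_coord_mul_exp hb]
  simp [Matrix.trace, Finset.mul_sum, mul_comm]

end Gaussian

section LaplaceBounds

theorem exp_le_one_add_add_sq_mul_exp_abs (x : ℝ) :
    Real.exp x ≤ 1 + x + x ^ 2 * Real.exp |x| := by
  have h := Complex.norm_exp_sub_sum_le_norm_mul_exp (x : ℂ) 2
  have h2 : Complex.exp x - ∑ m ∈ Finset.range 2, (x : ℂ) ^ m / (m.factorial : ℂ) =
      ((Real.exp x - (1 + x) : ℝ) : ℂ) := by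
    simp [Finset.sum_range_succ]
  rw [h2, Complex.norm_real, Complex.norm_real, Real.norm_eq_abs, Real.norm_eq_abs, sq_abs] at h
  linarith [le_abs_self (Real.exp x - (1 + x))]

theorem sq_le_exp_quarter {x : ℝ} (hx : 0 ≤ x) : x ^ 2 ≤ 32 * Real.exp (x / 4) := by
  have h := Real.pow_div_factorial_le_exp (x := x / 4) (by positivity) 2
  norm_num [Nat.factorial] at h
  linarith

theorem cubic_le_exp_eighth {x : ℝ} (hx : 0 ≤ x) :
    x + x ^ 2 + x ^ 3 ≤ 3208 * Real.exp (x / 8) := by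
  have h1 := Real.pow_div_factorial_le_exp (x := x / 8) (by positivity) 1
  have h2 := Real.pow_div_factorial_le_exp (x := x / 8) (by positivity) 2
  have h3 := Real.pow_div_factorial_le_exp (x := x / 8) (by positivity) 3
  norm_num [Nat.factorial, div_pow] at h1 h2 h3
  linarith

theorem cubic_combination_le {α p q s x : ℝ} (hα : 0 < α) (hp : 0 ≤ p) (hq : 0 ≤ q) (hs : 0 ≤ s)
    (hx : 0 ≤ x) :
    p / α * x + q / α * x ^ 2 + s / α * x ^ 3 * Real.exp (x / 8) ≤
      (p + q + s) / α * (3208 * Real.exp (x / 8)) * Real.exp (x / 8) := by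
  have he : (1:ℝ) ≤ Real.exp (x / 8) := Real.one_le_exp (by positivity)
  have h1 : p / α ≤ (p + q + s) / α := by gcongr; linarith
  have h2 : q / α ≤ (p + q + s) / α := by gcongr; linarith
  have h3 : s / α ≤ (p + q + s) / α := by gcongr; linarith
  calc p / α * x + q / α * x ^ 2 + s / α * x ^ 3 * Real.exp (x / 8)
      ≤ (p + q + s) / α * x + (p + q + s) / α * x ^ 2 +
          (p + q + s) / α * x ^ 3 * Real.exp (x / 8) := by gcongr
    _ ≤ (p + q + s) / α * x * Real.exp (x / 8) + (p + q + s) / α * x ^ 2 * Real.exp (x / 8) +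
          (p + q + s) / α * x ^ 3 * Real.exp (x / 8) := by
        refine add_le_add (add_le_add ?_ ?_) le_rfl
        · exact le_mul_of_one_le_right (by positivity) he
        · exact le_mul_of_one_le_right (by positivity) he
    _ = (p + q + s) / α * (x + x ^ 2 + x ^ 3) * Real.exp (x / 8) := by ring
    _ ≤ _ := by gcongr; exact cubic_le_exp_eighth hx

/-- The pointwise estimate behind the upper Laplace bound: `A`, `B` are the values of the phase and
`a`, `b` the values of the amplitude at two antipodal points of norm `ρ`. -/
theorem symmetrized_integrand_le {K c α ρ A B a b : ℝ} (hK : 0 ≤ K) (hc : 0 ≤ c) (hα : 0 < α)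
    (hρ0 : 0 ≤ ρ) (hρ1 : ρ ≤ 1) (hKρ : K * ρ ≤ 1 / 16)
    (hA : |A - ρ ^ 2 / 2| ≤ K * ρ ^ 3) (hB : |B - ρ ^ 2 / 2| ≤ K * ρ ^ 3)
    (hAB : |(A + B) / 2 - ρ ^ 2 / 2| ≤ K * ρ ^ 4) (ha0 : 0 ≤ a) (hb0 : 0 ≤ b)
    (ha : |a - c| ≤ K * ρ) (hb : |b - c| ≤ K * ρ) (hab : |(a + b) / 2 - c| ≤ K * ρ ^ 2) :
    (Real.exp (-α * A) * a + Real.exp (-α * B) * b) / 2 ≤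
      c * Real.exp (-(α / 2) * ρ ^ 2) +
        3208 * (K + K * (c + 2 * K) + K ^ 2 * (c + K)) / α * Real.exp (-(α / 4) * ρ ^ 2) := by
  set x := α * ρ ^ 2 with hx
  have hx0 : 0 ≤ x := by positivity
  have aux : ∀ D : ℝ, |D - ρ ^ 2 / 2| ≤ K * ρ ^ 3 →
      Real.exp (-α * D) ≤ Real.exp (-(x / 2)) *
        (1 + -α * (D - ρ ^ 2 / 2) + (α * (K * ρ ^ 3)) ^ 2 * Real.exp (x / 8)) := by
    intro D hD
    have h1 : Real.exp (-α * D) = Real.exp (-(x / 2)) * Real.exp (-α * (D - ρ ^ 2 / 2)) := by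
      rw [← Real.exp_add, hx]; congr 1; ring
    have h2 : |-α * (D - ρ ^ 2 / 2)| ≤ α * (K * ρ ^ 3) := by
      rw [abs_mul, abs_neg, abs_of_pos hα]; gcongr
    have h3 : α * (K * ρ ^ 3) ≤ x / 8 := by
      have : α * (K * ρ ^ 3) = x * (K * ρ) := by rw [hx]; ring
      rw [this]; nlinarith
    rw [h1]
    gcongr
    refine (exp_le_one_add_add_sq_mul_exp_abs _).trans ?_
    rw [← sq_abs (-α * (D - ρ ^ 2 / 2))]
    have h4 := h2.trans h3
    gcongr
  have hea := mul_le_mul_of_nonneg_right (aux A hA) ha0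
  have heb := mul_le_mul_of_nonneg_right (aux B hB) hb0
  have habc : (a + b) / 2 ≤ c + K * ρ ^ 2 := by linarith [(abs_le.1 hab).2]
  have habK : (a + b) / 2 ≤ c + K := by
    have : K * ρ ^ 2 ≤ K * 1 := by gcongr; exact pow_le_one₀ hρ0 hρ1
    linarith
  have hlin : -α * (A - ρ ^ 2 / 2) * a + -α * (B - ρ ^ 2 / 2) * b ≤
      2 * (α * ρ ^ 4 * (K * (c + 2 * K))) := by
    have e1 : -α * (A - ρ ^ 2 / 2) * a + -α * (B - ρ ^ 2 / 2) * b =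
        α * (-((A + B) / 2 - ρ ^ 2 / 2) * (2 * ((a + b) / 2)) +
          ((B - ρ ^ 2 / 2) - (A - ρ ^ 2 / 2)) / 2 * (a - b)) := by ring
    have e2 : -((A + B) / 2 - ρ ^ 2 / 2) * (2 * ((a + b) / 2)) ≤ K * ρ ^ 4 * (2 * (c + K)) := by
      have := (abs_le.1 hAB).1
      refine mul_le_mul (by linarith) (by linarith) (by positivity) (by positivity)
    have e3 : ((B - ρ ^ 2 / 2) - (A - ρ ^ 2 / 2)) / 2 * (a - b) ≤ K * ρ ^ 3 * (2 * (K * ρ)) := by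
      refine (le_abs_self _).trans ?_
      rw [abs_mul]
      have := abs_le.1 hA
      have := abs_le.1 hB
      have := abs_le.1 ha
      have := abs_le.1 hb
      refine mul_le_mul ?_ ?_ (abs_nonneg _) (by positivity)
      · rw [abs_le]; constructor <;> linarith
      · rw [abs_le]; constructor <;> linarith
    rw [e1]
    calc _ ≤ α * (K * ρ ^ 4 * (2 * (c + K)) + K * ρ ^ 3 * (2 * (K * ρ))) := by gcongr
      _ = _ := by ring
  have hsum : (Real.exp (-α * A) * a + Real.exp (-α * B) * b) / 2 ≤
      Real.exp (-(x / 2)) * (c + K * ρ ^ 2 + α * ρ ^ 4 * (K * (c + 2 * K)) +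
        (α * (K * ρ ^ 3)) ^ 2 * Real.exp (x / 8) * (c + K)) := by
    calc _ ≤ Real.exp (-(x / 2)) * ((a + b) / 2 +
          (-α * (A - ρ ^ 2 / 2) * a + -α * (B - ρ ^ 2 / 2) * b) / 2 +
          (α * (K * ρ ^ 3)) ^ 2 * Real.exp (x / 8) * ((a + b) / 2)) := by
            linear_combination (1 / 2) * hea + (1 / 2) * heb
      _ ≤ _ := by gcongr; linarith
  have hpoly : K * ρ ^ 2 + α * ρ ^ 4 * (K * (c + 2 * K)) +
        (α * (K * ρ ^ 3)) ^ 2 * Real.exp (x / 8) * (c + K) ≤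
      (K + K * (c + 2 * K) + K ^ 2 * (c + K)) / α * (3208 * Real.exp (x / 8)) *
        Real.exp (x / 8) := by
    have e1 : K * ρ ^ 2 = K / α * x := by rw [div_mul_eq_mul_div, eq_div_iff hα.ne']; ring
    have e2 : α * ρ ^ 4 * (K * (c + 2 * K)) = K * (c + 2 * K) / α * x ^ 2 := by
      rw [div_mul_eq_mul_div, eq_div_iff hα.ne']; ring
    have e3 : (α * (K * ρ ^ 3)) ^ 2 * Real.exp (x / 8) * (c + K) =
        K ^ 2 * (c + K) / α * x ^ 3 * Real.exp (x / 8) := by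
      rw [div_mul_eq_mul_div, div_mul_eq_mul_div, eq_div_iff hα.ne']; ring
    rw [e1, e2, e3]
    exact cubic_combination_le hα hK (by positivity) (by positivity) hx0
  have he2 : Real.exp (-(α / 2) * ρ ^ 2) = Real.exp (-(x / 2)) := by
    rw [hx]; congr 1; ring
  have he3 : Real.exp (-(α / 4) * ρ ^ 2) =
      Real.exp (-(x / 2)) * (Real.exp (x / 8) * Real.exp (x / 8)) := by
    rw [← Real.exp_add, ← Real.exp_add, hx]; congr 1; ring
  rw [he2, he3]
  refine hsum.trans ?_
  calc _ ≤ Real.exp (-(x / 2)) * (c + (K + K * (c + 2 * K) + K ^ 2 * (c + K)) / α *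
        (3208 * Real.exp (x / 8)) * Real.exp (x / 8)) :=
          mul_le_mul_of_nonneg_left (by linarith) (Real.exp_pos _).le
    _ = _ := by ring

/-- The Gaussian integral of variance `1 / α`. -/
theorem integral_exp_neg_half_mul {d : ℕ} {α : ℝ} (hα : 0 < α) :
    ∫ z : E d, Real.exp (-(α / 2) * ‖z‖ ^ 2) = (2 * Real.pi / α) ^ ((d : ℝ) / 2) := by
  rw [integral_exp_neg_mul_sq_norm (half_pos hα)]
  congr 1
  field_simp

theorem integral_exp_neg_quarter_mul {d : ℕ} {α : ℝ} (hα : 0 < α) :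
    ∫ z : E d, Real.exp (-(α / 4) * ‖z‖ ^ 2) =
      (2 * Real.pi / α) ^ ((d : ℝ) / 2) * 2 ^ ((d : ℝ) / 2) := by
  rw [integral_exp_neg_mul_sq_norm (by positivity), ← Real.mul_rpow (by positivity) (by positivity)]
  congr 1
  field_simp
  norm_num

/-- Lower Laplace bound for the partition function. -/
theorem laplace_lower_bound {d : ℕ} {G : E d → ℝ} {K r : ℝ} (hK : 0 < K) (hr : 0 < r)
    (hG4 : ∀ z, ‖z‖ ≤ r → (G z + G (-z)) / 2 ≤ ‖z‖ ^ 2 / 2 + K * ‖z‖ ^ 4) {α : ℝ} (hα : 0 < α)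
    (hαr : 1 ≤ α * K * r ^ 4) (hint : Integrable fun z => Real.exp (-α * G z)) :
    (2 * Real.pi / α) ^ ((d : ℝ) / 2) * (1 - 32 * K * 2 ^ ((d : ℝ) / 2) / α) ≤
      ∫ z, Real.exp (-α * G z) := by
  have hint' : Integrable fun z => Real.exp (-α * G (-z)) := hint.comp_neg
  have hsym : ∫ z, Real.exp (-α * G z) =
      ∫ z, (Real.exp (-α * G z) + Real.exp (-α * G (-z))) / 2 := by
    rw [integral_div, integral_add hint hint',
      integral_neg_eq_self (fun z => Real.exp (-α * G z)) volume]
    ring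
  have hpt : ∀ z : E d, Real.exp (-(α / 2) * ‖z‖ ^ 2) -
      32 * K / α * Real.exp (-(α / 4) * ‖z‖ ^ 2) ≤
      (Real.exp (-α * G z) + Real.exp (-α * G (-z))) / 2 := by
    intro z
    have h1 : Real.exp (-(α / 2) * ‖z‖ ^ 2) - 32 * K / α * Real.exp (-(α / 4) * ‖z‖ ^ 2) ≤
        Real.exp (-(α / 2) * ‖z‖ ^ 2) * (1 - α * K * ‖z‖ ^ 4) := by
      have e1 : Real.exp (-(α / 4) * ‖z‖ ^ 2) =
          Real.exp (-(α / 2) * ‖z‖ ^ 2) * Real.exp (α * ‖z‖ ^ 2 / 4) := by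
        rw [← Real.exp_add]; congr 1; ring
      have e2 := sq_le_exp_quarter (x := α * ‖z‖ ^ 2) (by positivity)
      have e3 : α * K * ‖z‖ ^ 4 ≤ 32 * K / α * Real.exp (α * ‖z‖ ^ 2 / 4) := by
        calc α * K * ‖z‖ ^ 4 = K / α * (α * ‖z‖ ^ 2) ^ 2 := by field_simp
          _ ≤ K / α * (32 * Real.exp (α * ‖z‖ ^ 2 / 4)) := by gcongr
          _ = _ := by ring
      rw [e1]
      linear_combination Real.exp (-(α / 2) * ‖z‖ ^ 2) * e3
    refine h1.trans ?_
    by_cases hz : ‖z‖ ≤ r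
    · have h2 : Real.exp (-α * ((G z + G (-z)) / 2)) ≤
          (Real.exp (-α * G z) + Real.exp (-α * G (-z))) / 2 := by
        have e : Real.exp (-α * ((G z + G (-z)) / 2)) ^ 2 =
            Real.exp (-α * G z) * Real.exp (-α * G (-z)) := by
          rw [sq, ← Real.exp_add, ← Real.exp_add]; congr 1; ring
        nlinarith [sq_nonneg (Real.exp (-α * G z) - Real.exp (-α * G (-z))),
          Real.exp_pos (-α * G z), Real.exp_pos (-α * G (-z)),
          Real.exp_pos (-α * ((G z + G (-z)) / 2))]
      refine le_trans ?_ h2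
      have h3 : Real.exp (-(α / 2) * ‖z‖ ^ 2) * Real.exp (-(α * K * ‖z‖ ^ 4)) ≤
          Real.exp (-α * ((G z + G (-z)) / 2)) := by
        rw [← Real.exp_add]
        refine Real.exp_le_exp.2 ?_
        linear_combination α * hG4 z hz
      refine le_trans ?_ h3
      gcongr
      linarith [Real.add_one_le_exp (-(α * K * ‖z‖ ^ 4))]
    · push Not at hz
      have h2 : 1 - α * K * ‖z‖ ^ 4 ≤ 0 := by
        have : α * K * r ^ 4 ≤ α * K * ‖z‖ ^ 4 := by gcongr
        linarith
      exact (mul_nonpos_of_nonneg_of_nonpos (Real.exp_pos _).le h2).trans (by positivity)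
  have hg1 := integrable_exp_neg_mul_sq_norm (d := d) (half_pos hα)
  have hg2 := (integrable_exp_neg_mul_sq_norm (d := d) (b := α / 4) (by positivity)).const_mul
    (32 * K / α)
  rw [hsym]
  refine le_trans (le_of_eq ?_) (integral_mono (hg1.sub hg2) ((hint.add hint').div_const 2) hpt)
  rw [integral_sub' hg1 hg2, integral_const_mul, integral_exp_neg_half_mul hα,
    integral_exp_neg_quarter_mul hα]
  ring

/-- The contribution of the complement of a ball to a Laplace integral is negligible. -/
theorem laplace_tail {d : ℕ} {G Ψ : E d → ℝ} {η r : ℝ} (hη : 0 < η) (hΨ : ∀ z, 0 ≤ Ψ z)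
    (hGr : ∀ z, r < ‖z‖ → η ≤ G z)
    (hint2 : Integrable fun z => Real.exp (-2 * G z) * Ψ z)
    (hint : ∀ α, 2 ≤ α → Integrable fun z => Real.exp (-α * G z) * Ψ z) {ε : ℝ} (hε : 0 < ε) :
    ∃ α₀ ≥ 2, ∀ α ≥ α₀, ∫ z in (Metric.closedBall 0 r)ᶜ, Real.exp (-α * G z) * Ψ z ≤
      (2 * Real.pi / α) ^ ((d : ℝ) / 2) * (ε / α) := by
  set D := ∫ z, Real.exp (-2 * G z) * Ψ z with hD
  have hD0 : 0 ≤ D := integral_nonneg fun z => mul_nonneg (Real.exp_pos _).le (hΨ z)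
  have hlim := tendsto_rpow_mul_exp_neg_mul_atTop_nhds_zero ((d : ℝ) / 2 + 1) η hη
  have hpos : 0 < ε * (2 * Real.pi) ^ ((d : ℝ) / 2) / (Real.exp (2 * η) * (D + 1)) := by positivity
  obtain ⟨α₁, hα₁⟩ := Filter.eventually_atTop.1 (hlim.eventually (gt_mem_nhds hpos))
  refine ⟨max α₁ 2, le_max_right _ _, fun α hα => ?_⟩
  have hα2 : 2 ≤ α := (le_max_right _ _).trans hα
  have hα0 : 0 < α := by linarith
  have h1 : ∫ z in (Metric.closedBall 0 r)ᶜ, Real.exp (-α * G z) * Ψ z ≤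
      Real.exp (-(α - 2) * η) * D := by
    calc _ ≤ ∫ z in (Metric.closedBall 0 r)ᶜ,
          Real.exp (-(α - 2) * η) * (Real.exp (-2 * G z) * Ψ z) := by
            refine setIntegral_mono_on (hint α hα2).integrableOn
              (hint2.const_mul _).integrableOn Metric.isClosed_closedBall.measurableSet.compl
              fun z hz => ?_
            have hz' : r < ‖z‖ := by simpa using hz
            rw [← mul_assoc, ← Real.exp_add]
            refine mul_le_mul_of_nonneg_right (Real.exp_le_exp.2 ?_) (hΨ z)
            nlinarith [hGr z hz']
      _ ≤ ∫ z, Real.exp (-(α - 2) * η) * (Real.exp (-2 * G z) * Ψ z) :=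
            setIntegral_le_integral (hint2.const_mul _) (Filter.Eventually.of_forall fun z =>
              mul_nonneg (Real.exp_pos _).le (mul_nonneg (Real.exp_pos _).le (hΨ z)))
      _ = _ := integral_const_mul _ _
  refine h1.trans ?_
  have h2 := hα₁ α ((le_max_left _ _).trans hα)
  rw [Real.div_rpow (by positivity) hα0.le]
  rw [lt_div_iff₀ (by positivity), Real.rpow_add hα0, Real.rpow_one] at h2
  have e : Real.exp (-(α - 2) * η) = Real.exp (2 * η) * Real.exp (-η * α) := by
    rw [← Real.exp_add]; congr 1; ring
  rw [e, div_mul_div_comm, le_div_iff₀ (by positivity)]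
  calc _ = α ^ ((d : ℝ) / 2) * α * Real.exp (-η * α) * (Real.exp (2 * η) * D) := by ring
    _ ≤ α ^ ((d : ℝ) / 2) * α * Real.exp (-η * α) * (Real.exp (2 * η) * (D + 1)) := by
        gcongr; linarith
    _ ≤ _ := by linarith

/-- Upper Laplace bound with a relative error of order `1 / α`. -/
theorem laplace_upper_bound {d : ℕ} {G Ψ : E d → ℝ} {K : ℝ} (hK : 0 < K)
    (hG3 : ∀ z, ‖z‖ ≤ 1 → |G z - ‖z‖ ^ 2 / 2| ≤ K * ‖z‖ ^ 3)
    (hG4 : ∀ z, ‖z‖ ≤ 1 → |(G z + G (-z)) / 2 - ‖z‖ ^ 2 / 2| ≤ K * ‖z‖ ^ 4)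
    (hGr : ∀ r > 0, ∃ η > 0, ∀ z, r < ‖z‖ → η ≤ G z)
    (hΨ : ∀ z, 0 ≤ Ψ z)
    (hΨ1 : ∀ z, ‖z‖ ≤ 1 → |Ψ z - Ψ 0| ≤ K * ‖z‖)
    (hΨ2 : ∀ z, ‖z‖ ≤ 1 → |(Ψ z + Ψ (-z)) / 2 - Ψ 0| ≤ K * ‖z‖ ^ 2)
    (hint : ∀ α, 2 ≤ α → Integrable fun z => Real.exp (-α * G z) * Ψ z) :
    ∃ C > 0, ∃ α₀ ≥ 2, ∀ α ≥ α₀, ∫ z, Real.exp (-α * G z) * Ψ z ≤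
      (2 * Real.pi / α) ^ ((d : ℝ) / 2) * (Ψ 0 + C / α) := by
  set r : ℝ := min 1 (1 / (16 * K)) with hrdef
  have hr : 0 < r := by positivity
  have hr1 : r ≤ 1 := min_le_left _ _
  have hrK : K * r ≤ 1 / 16 := by
    calc K * r ≤ K * (1 / (16 * K)) := by gcongr; exact min_le_right _ _
      _ = _ := by field_simp
  obtain ⟨η, hη, hGη⟩ := hGr r hr
  obtain ⟨α₀, hα₀, htail⟩ := laplace_tail hη hΨ hGη (hint 2 le_rfl) hint one_pos
  set c := Ψ 0
  have hc : 0 ≤ c := hΨ 0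
  set C := 3208 * (K + K * (c + 2 * K) + K ^ 2 * (c + K)) with hC
  refine ⟨C * 2 ^ ((d : ℝ) / 2) + 1, by positivity, α₀, hα₀, fun α hα => ?_⟩
  have hα0 : 0 < α := by linarith
  have hi := hint α (hα₀.trans hα)
  set B := Metric.closedBall (0 : E d) r
  have hBm : MeasurableSet B := Metric.isClosed_closedBall.measurableSet
  let h : E d → ℝ := B.indicator fun z => Real.exp (-α * G z) * Ψ z
  have hh : Integrable h := hi.indicator hBm
  have hsym : ∫ z in B, Real.exp (-α * G z) * Ψ z = ∫ z, (h z + h (-z)) / 2 := by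
    rw [integral_div, integral_add hh hh.comp_neg, integral_neg_eq_self h volume,
      ← integral_indicator hBm]
    ring
  have hg1 := (integrable_exp_neg_mul_sq_norm (d := d) (half_pos hα0)).const_mul c
  have hg2 := (integrable_exp_neg_mul_sq_norm (d := d) (b := α / 4) (by positivity)).const_mul
    (C / α)
  have hball : ∫ z in B, Real.exp (-α * G z) * Ψ z ≤
      (2 * Real.pi / α) ^ ((d : ℝ) / 2) * (c + C * 2 ^ ((d : ℝ) / 2) / α) := by
    rw [hsym]
    refine (integral_mono ((hh.add hh.comp_neg).div_const 2) (hg1.add hg2) fun z => ?_).trans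
      (le_of_eq ?_)
    · simp only [Pi.add_apply]
      by_cases hz : z ∈ B
      · have hz' : -z ∈ B := by simpa [B] using hz
        have hzr : ‖z‖ ≤ r := by simpa [B] using hz
        have hz1 : ‖z‖ ≤ 1 := hzr.trans hr1
        have hn1 : ‖-z‖ ≤ 1 := by rwa [norm_neg]
        simp only [h, Set.indicator_of_mem hz, Set.indicator_of_mem hz']
        have a1 := hG3 _ hn1
        have a2 := hΨ1 _ hn1
        rw [norm_neg] at a1 a2
        exact symmetrized_integrand_le hK.le hc hα0 (norm_nonneg z) hz1
          ((mul_le_mul_of_nonneg_left hzr hK.le).trans hrK) (hG3 z hz1) a1 (hG4 z hz1) (hΨ z)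
          (hΨ _) (hΨ1 z hz1) a2 (hΨ2 z hz1)
      · have hz' : -z ∉ B := by simpa [B] using hz
        simp only [h, Set.indicator_of_notMem hz, Set.indicator_of_notMem hz']
        simp only [add_zero, zero_div]
        positivity
    · rw [integral_add' hg1 hg2, integral_const_mul, integral_const_mul,
        integral_exp_neg_half_mul hα0, integral_exp_neg_quarter_mul hα0]
      ring
  rw [← integral_add_compl hBm hi]
  calc _ ≤ (2 * Real.pi / α) ^ ((d : ℝ) / 2) * (c + C * 2 ^ ((d : ℝ) / 2) / α) +
        (2 * Real.pi / α) ^ ((d : ℝ) / 2) * (1 / α) := add_le_add hball (htail α hα)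
    _ = _ := by ring

theorem exists_rpow_inv_mul_inv_le (s : ℝ) {c : ℝ} (hc : 1 < c) :
    ∃ ρ : ℝ, 0 < ρ ∧ ρ < 1 ∧ (1 / ρ) ^ s * (1 / ρ) ≤ c := by
  have hcont : ContinuousAt (fun t : ℝ => (1 / t) ^ s * (1 / t)) 1 := by
    have h1 : ContinuousAt (fun t : ℝ => 1 / t) 1 := by
      simp [one_div]
    exact (h1.rpow_const (Or.inl (by simp))).mul h1
  have h2 : ∀ᶠ t in nhds (1 : ℝ), (1 / t) ^ s * (1 / t) < c :=
    hcont.eventually (gt_mem_nhds (by simpa using hc))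
  have h3 : ∀ᶠ t in nhdsWithin (1 : ℝ) (Set.Iio 1), 0 < t ∧ t < 1 :=
    Filter.Eventually.and (nhdsWithin_le_nhds (lt_mem_nhds one_pos)) self_mem_nhdsWithin
  obtain ⟨t, ⟨h4, h5⟩, h6⟩ := (h3.and (nhdsWithin_le_nhds h2)).exists
  exact ⟨t, h4, h5, h6.le⟩

/-- Upper Laplace bound for an amplitude vanishing to second order at the minimizer. -/
theorem laplace_upper_bound_of_vanishing {d : ℕ} (hd : 1 ≤ d) {G Ψ : E d → ℝ} {K : ℝ} (hK : 0 < K)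
    (hG3 : ∀ z, ‖z‖ ≤ 1 → |G z - ‖z‖ ^ 2 / 2| ≤ K * ‖z‖ ^ 3)
    (hGr : ∀ r > 0, ∃ η > 0, ∀ z, r < ‖z‖ → η ≤ G z)
    (hΨ : ∀ z, 0 ≤ Ψ z) {M : Matrix (Fin d) (Fin d) ℝ} (hM : 0 < M.trace)
    (hΨ2 : ∀ ε > 0, ∃ r > 0, ∀ z, ‖z‖ ≤ r → Ψ z ≤ quadForm M z / 2 + ε * ‖z‖ ^ 2)
    (hint : ∀ α, 2 ≤ α → Integrable fun z => Real.exp (-α * G z) * Ψ z) :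
    ∃ α₀ ≥ 2, ∀ α ≥ α₀, ∫ z, Real.exp (-α * G z) * Ψ z ≤
      (2 * Real.pi / α) ^ ((d : ℝ) / 2) * (M.trace / α) := by
  obtain ⟨ρ, hρ0, hρ1, hρ⟩ := exists_rpow_inv_mul_inv_le ((d : ℝ) / 2) (c := 5 / 4) (by norm_num)
  have hd0 : (0:ℝ) < d := by exact_mod_cast hd
  set ε := M.trace / (16 * d) with hε
  have hε0 : 0 < ε := by positivity
  obtain ⟨r₁, hr₁, hΨr⟩ := hΨ2 ε hε0
  set r := min r₁ (min 1 ((1 - ρ) / (2 * K))) with hrdef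
  have h1ρ : 0 < 1 - ρ := by linarith
  have hr : 0 < r := by positivity
  have hr1 : r ≤ 1 := (min_le_right _ _).trans (min_le_left _ _)
  have hrr₁ : r ≤ r₁ := min_le_left _ _
  have hrK : K * r ≤ (1 - ρ) / 2 := by
    calc K * r ≤ K * ((1 - ρ) / (2 * K)) := by
          gcongr; exact (min_le_right _ _).trans (min_le_right _ _)
      _ = _ := by field_simp
  obtain ⟨η, hη, hGη⟩ := hGr r hr
  obtain ⟨α₀, hα₀, htail⟩ := laplace_tail hη hΨ hGη (hint 2 le_rfl) hint
    (ε := M.trace / 4) (by positivity)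
  refine ⟨α₀, hα₀, fun α hα => ?_⟩
  have hα0 : 0 < α := by linarith
  have hi := hint α (hα₀.trans hα)
  set B := Metric.closedBall (0 : E d) r
  have hBm : MeasurableSet B := Metric.isClosed_closedBall.measurableSet
  set N : Matrix (Fin d) (Fin d) ℝ := M + (2 * ε) • 1 with hN
  have hNtr : N.trace = M.trace * (9 / 8) := by
    rw [hN, Matrix.trace_add, Matrix.trace_smul, Matrix.trace_one, Fintype.card_fin, smul_eq_mul, hε]
    field_simp
    norm_num
  have hNball : ∀ z, ‖z‖ ≤ r → Ψ z ≤ quadForm N z / 2 := by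
    intro z hz
    rw [hN, quadForm_add_smul_one]
    linarith [hΨr z (hz.trans hrr₁)]
  have hN0 : ∀ z, 0 ≤ quadForm N z := quadForm_nonneg_of_ball hr fun z hz => by
    linarith [hΨ z, hNball z hz]
  have hb : 0 < α * ρ / 2 := by positivity
  obtain ⟨hqi, hqv⟩ := integral_quadForm_mul_exp hb N
  have hball : ∫ z in B, Real.exp (-α * G z) * Ψ z ≤
      (2 * Real.pi / α) ^ ((d : ℝ) / 2) * (M.trace * (45 / 64) / α) := by
    calc ∫ z in B, Real.exp (-α * G z) * Ψ z
        ≤ ∫ z in B, 1 / 2 * (quadForm N z * Real.exp (-(α * ρ / 2) * ‖z‖ ^ 2)) := by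
          refine setIntegral_mono_on hi.integrableOn (hqi.const_mul _).integrableOn hBm
            fun z hz => ?_
          have hzr : ‖z‖ ≤ r := by simpa [B] using hz
          have h1 : Real.exp (-α * G z) ≤ Real.exp (-(α * ρ / 2) * ‖z‖ ^ 2) := by
            refine Real.exp_le_exp.2 ?_
            have e1 := (abs_le.1 (hG3 z (hzr.trans hr1))).1
            have e2 : K * ‖z‖ ^ 3 ≤ (1 - ρ) / 2 * ‖z‖ ^ 2 := by
              calc K * ‖z‖ ^ 3 = K * ‖z‖ * ‖z‖ ^ 2 := by ring
                _ ≤ K * r * ‖z‖ ^ 2 := by gcongr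
                _ ≤ _ := by gcongr
            have e3 : ρ / 2 * ‖z‖ ^ 2 ≤ G z := by linarith
            linear_combination α * e3
          calc _ ≤ Real.exp (-(α * ρ / 2) * ‖z‖ ^ 2) * (quadForm N z / 2) :=
                mul_le_mul h1 (hNball z hzr) (hΨ z) (Real.exp_pos _).le
            _ = _ := by ring
      _ ≤ ∫ z, 1 / 2 * (quadForm N z * Real.exp (-(α * ρ / 2) * ‖z‖ ^ 2)) :=
          setIntegral_le_integral (hqi.const_mul _) (Filter.Eventually.of_forall fun z =>
            mul_nonneg (by norm_num) (mul_nonneg (hN0 z) (Real.exp_pos _).le))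
      _ = (2 * Real.pi / α) ^ ((d : ℝ) / 2) * (M.trace * (9 / 16) / α) *
            ((1 / ρ) ^ ((d : ℝ) / 2) * (1 / ρ)) := by
          rw [integral_const_mul, hqv, hNtr]
          have e1 : Real.pi / (α * ρ / 2) = 2 * Real.pi / α * (1 / ρ) := by field_simp
          rw [e1, Real.mul_rpow (by positivity) (by positivity)]
          field_simp
          norm_num
      _ ≤ (2 * Real.pi / α) ^ ((d : ℝ) / 2) * (M.trace * (9 / 16) / α) * (5 / 4) := by gcongr
      _ = _ := by ring
  rw [← integral_add_compl hBm hi]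
  have hp : 0 ≤ (2 * Real.pi / α) ^ ((d : ℝ) / 2) := by positivity
  calc _ ≤ (2 * Real.pi / α) ^ ((d : ℝ) / 2) * (M.trace * (45 / 64) / α) +
        (2 * Real.pi / α) ^ ((d : ℝ) / 2) * (M.trace / 4 / α) := add_le_add hball (htail α hα)
    _ = (2 * Real.pi / α) ^ ((d : ℝ) / 2) * (M.trace / α) * (61 / 64) := by ring
    _ ≤ (2 * Real.pi / α) ^ ((d : ℝ) / 2) * (M.trace / α) :=
        mul_le_of_le_one_right (by positivity) (by norm_num)

end LaplaceBounds

section Normalization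

open scoped MatrixOrder Matrix.Norms.L2Operator in
/-- A positive definite matrix is congruent to the identity. -/
theorem exists_normalizing_matrix {d : ℕ} {H : Matrix (Fin d) (Fin d) ℝ} (hH : H.PosDef) :
    ∃ B : Matrix (Fin d) (Fin d) ℝ, B.transpose * H * B = 1 ∧ B * B.transpose = H⁻¹ ∧
      |B.det| = 1 / √H.det := by
  obtain ⟨C, hC, hHC⟩ := CStarAlgebra.isStrictlyPositive_iff_eq_star_mul_self.mp
    hH.isStrictlyPositive
  rw [Matrix.star_eq_conjTranspose, Matrix.conjTranspose_eq_transpose_of_trivial] at hHC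
  have hdet : IsUnit C.det := (Matrix.isUnit_iff_isUnit_det C).1 hC
  have hdetT : IsUnit C.transpose.det := by rwa [Matrix.det_transpose]
  refine ⟨C⁻¹, ?_, ?_, ?_⟩
  · rw [hHC, Matrix.transpose_nonsing_inv, ← mul_assoc, Matrix.nonsing_inv_mul _ hdetT, one_mul,
      Matrix.mul_nonsing_inv _ hdet]
  · rw [hHC, Matrix.mul_inv_rev, Matrix.transpose_nonsing_inv]
  · rw [hHC, Matrix.det_mul, Matrix.det_transpose, Real.sqrt_mul_self_eq_abs, Matrix.det_nonsing_inv,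
      Ring.inverse_eq_inv', abs_inv, one_div]

/-- The linear equivalence of an invertible matrix, acting on `ℝ^d`. -/
theorem exists_continuousLinearEquiv_of_det_ne_zero {d : ℕ} {B : Matrix (Fin d) (Fin d) ℝ}
    (hB : B.det ≠ 0) :
    ∃ T : E d ≃L[ℝ] E d, (∀ z i, T z i = ∑ j, B i j * z j) ∧
      LinearMap.det ((T : E d →L[ℝ] E d) : E d →ₗ[ℝ] E d) = B.det := by
  have h1 : LinearMap.det (Matrix.toEuclideanLin B) = B.det := LinearMap.det_toLpLin 2 B
  have h2 : LinearMap.det (Matrix.toEuclideanLin B) ≠ 0 := by rwa [h1]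
  refine ⟨((Matrix.toEuclideanLin B).equivOfDetNeZero h2).toContinuousLinearEquiv, ?_, ?_⟩
  · intro z i
    rfl
  · rw [← h1]
    rfl

theorem quadForm_comp {d : ℕ} (A B : Matrix (Fin d) (Fin d) ℝ) {T : E d → E d}
    (hT : ∀ z i, T z i = ∑ j, B i j * z j) (z : E d) :
    quadForm A (T z) = quadForm (B.transpose * A * B) z := by
  have h : ∀ (M : Matrix (Fin d) (Fin d) ℝ) (z : E d),
      quadForm M z = z.ofLp ⬝ᵥ M.mulVec z.ofLp := by
    intro M z
    simp only [quadForm, dotProduct, Matrix.mulVec, Finset.mul_sum]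
    exact Finset.sum_congr rfl fun i _ => Finset.sum_congr rfl fun j _ => by ring
  have hT' : (T z).ofLp = B.mulVec z.ofLp := by
    ext i; rw [hT]; rfl
  rw [h, h, hT', ← Matrix.mulVec_mulVec, ← Matrix.mulVec_mulVec, Matrix.dotProduct_mulVec z.ofLp,
    Matrix.vecMul_transpose]

theorem quadForm_one {d : ℕ} (z : E d) : quadForm 1 z = ‖z‖ ^ 2 := by
  simpa [quadForm] using quadForm_add_smul_one (0 : Matrix (Fin d) (Fin d) ℝ) 1 z

/-- The change of variables `x = a + T z`. -/
theorem integral_comp_add_continuousLinearEquiv {d : ℕ} (T : E d ≃L[ℝ] E d) (a : E d)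
    (h : E d → ℝ) :
    ∫ x, h x = |LinearMap.det ((T : E d →L[ℝ] E d) : E d →ₗ[ℝ] E d)| * ∫ z, h (a + T z) := by
  set D := LinearMap.det ((T : E d →L[ℝ] E d) : E d →ₗ[ℝ] E d) with hD
  have hD0 : D ≠ 0 := (LinearEquiv.isUnit_det' T.toLinearEquiv).ne_zero
  have hmap := Measure.map_linearMap_addHaar_eq_smul_addHaar (volume : Measure (E d)) hD0
  have h1 : ∫ z, h (a + T z) = ∫ y, h (a + y) ∂(Measure.map T volume) :=
    (T.toHomeomorph.measurableEmbedding.integral_map (μ := volume) fun y => h (a + y)).symm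
  have h2 : Measure.map T volume = ENNReal.ofReal |D⁻¹| • (volume : Measure (E d)) := hmap
  rw [h1, h2, integral_smul_measure, integral_add_left_eq_self, ENNReal.toReal_ofReal (abs_nonneg _),
    smul_eq_mul, abs_inv, mul_inv_cancel_left₀ (abs_ne_zero.2 hD0)]

theorem integrable_comp_add_continuousLinearEquiv {d : ℕ} (T : E d ≃L[ℝ] E d) (a : E d)
    {h : E d → ℝ} (hh : Integrable h) : Integrable fun z => h (a + T z) := by
  set D := LinearMap.det ((T : E d →L[ℝ] E d) : E d →ₗ[ℝ] E d) with hD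
  have hD0 : D ≠ 0 := (LinearEquiv.isUnit_det' T.toLinearEquiv).ne_zero
  have hmap : Measure.map T volume = ENNReal.ofReal |D⁻¹| • (volume : Measure (E d)) :=
    Measure.map_linearMap_addHaar_eq_smul_addHaar (volume : Measure (E d)) hD0
  have h1 : Integrable (fun y => h (a + y)) (Measure.map T volume) := by
    rw [hmap]
    exact (hh.comp_add_left a).smul_measure ENNReal.ofReal_ne_top
  exact (T.toHomeomorph.measurableEmbedding.integrable_map_iff).1 h1

end Normalization

section TaylorExpansion

theorem sum_smul_bvec {d : ℕ} (y : E d) : ∑ i, y i • bvec d i = y := by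
  ext j
  simp [bvec, EuclideanSpace.single, Pi.single_apply]

theorem iteratedFDeriv_two_apply_const {d : ℕ} (f : E d → ℝ) (x y : E d) :
    (iteratedFDeriv ℝ 2 f x fun _ => y) = quadForm (hess f x) y := by
  have h0 : (fun _ : Fin 2 => y) = fun _ : Fin 2 => ∑ i, y i • bvec d i := by
    rw [sum_smul_bvec]
  rw [h0]
  simp only [iteratedFDeriv_two_apply, map_sum, map_smul, sum_apply,
    smul_apply, quadForm, hess, Matrix.of_apply, smul_eq_mul, Matrix.cons_val_zero,
    Matrix.cons_val_one]
  simp only [Finset.mul_sum]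
  rw [Finset.sum_comm]
  exact Finset.sum_congr rfl fun i _ => Finset.sum_congr rfl fun j _ => by ring

theorem iteratedFDeriv_apply_neg {d : ℕ} (n : ℕ) (f : E d → ℝ) (x y : E d) :
    (iteratedFDeriv ℝ n f x fun _ => -y) = (-1) ^ n * iteratedFDeriv ℝ n f x fun _ => y := by
  have := (iteratedFDeriv ℝ n f x).map_smul_univ (fun _ => (-1 : ℝ)) fun _ => y
  simpa using this

theorem quadForm_neg {d : ℕ} (M : Matrix (Fin d) (Fin d) ℝ) (z : E d) :
    quadForm M (-z) = quadForm M z := by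
  simp [quadForm]

theorem taylorSum_two {d : ℕ} (f : E d → ℝ) (x y : E d) :
    taylorSum 2 f x y = f x + fderiv ℝ f x y + quadForm (hess f x) y / 2 := by
  simp only [taylorSum, Nat.reduceAdd, Finset.sum_range_succ, Finset.range_zero,
    Finset.sum_empty, zero_add, iteratedFDeriv_two_apply_const, iteratedFDeriv_one_apply,
    iteratedFDeriv_zero_apply, smul_eq_mul]
  norm_num [Nat.factorial]
  ring

theorem taylorSum_three {d : ℕ} (f : E d → ℝ) (x y : E d) :
    taylorSum 3 f x y = f x + fderiv ℝ f x y + quadForm (hess f x) y / 2 +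
      (iteratedFDeriv ℝ 3 f x fun _ => y) / 6 := by
  rw [← taylorSum_two, taylorSum, Finset.sum_range_succ, taylorSum, smul_eq_mul]
  norm_num [Nat.factorial]
  ring

theorem exists_phase_bounds {d : ℕ} {f : E d → ℝ} (hf : ContDiff ℝ 4 f) {x : E d}
    (hx : fderiv ℝ f x = 0) (R : ℝ) :
    ∃ K > 0, ∀ y, ‖y‖ ≤ R →
      |f (x + y) - f x - quadForm (hess f x) y / 2| ≤ K * ‖y‖ ^ 3 ∧
      |(f (x + y) - f x + (f (x + -y) - f x)) / 2 - quadForm (hess f x) y / 2| ≤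
        K * ‖y‖ ^ 4 := by
  obtain ⟨K₁, hK₁, h₁⟩ := exists_taylor_bound (n := 2) (hf.of_le (by norm_num)) x R
  obtain ⟨K₂, hK₂, h₂⟩ := exists_taylor_bound (n := 3) (hf.of_le (by norm_num)) x R
  refine ⟨K₁ + K₂, by positivity, fun y hy => ⟨?_, ?_⟩⟩
  · have h := h₁ y hy
    rw [taylorSum_two, hx] at h
    calc _ = |f (x + y) - (f x + (0 : E d →L[ℝ] ℝ) y + quadForm (hess f x) y / 2)| := by
          congr 1; simp; ring
      _ ≤ _ := h.trans (by gcongr; linarith)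
  · have h := h₂ y hy
    have h' := h₂ (-y) (by rwa [norm_neg])
    rw [taylorSum_three, hx] at h h'
    rw [quadForm_neg, iteratedFDeriv_apply_neg, norm_neg] at h'
    simp only [zero_apply] at h h'
    have a := abs_le.1 h
    have a' := abs_le.1 h'
    have hK : 0 ≤ K₁ * ‖y‖ ^ 4 := by positivity
    norm_num at a a'
    rw [abs_le]
    constructor <;> linarith

theorem exists_amplitude_bounds {d : ℕ} {ψ : E d → ℝ} (hψ : ContDiff ℝ 2 ψ) (x : E d) (R : ℝ) :
    ∃ K > 0, ∀ y, ‖y‖ ≤ R → |ψ (x + y) - ψ x| ≤ K * ‖y‖ ∧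
      |(ψ (x + y) + ψ (x + -y)) / 2 - ψ x| ≤ K * ‖y‖ ^ 2 := by
  obtain ⟨K₁, hK₁, h₁⟩ := exists_taylor_bound (n := 0) (hψ.of_le (by norm_num)) x R
  obtain ⟨K₂, hK₂, h₂⟩ := exists_taylor_bound (n := 1) (hψ.of_le (by norm_num)) x R
  refine ⟨K₁ + K₂, by positivity, fun y hy => ⟨?_, ?_⟩⟩
  · have h := h₁ y hy
    simp only [taylorSum, zero_add, Finset.range_one, Finset.sum_singleton, Nat.factorial_zero,
      Nat.cast_one, inv_one, one_smul, iteratedFDeriv_zero_apply, pow_one] at h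
    exact h.trans (by gcongr; linarith)
  · have hT : ∀ y, taylorSum 1 ψ x y = ψ x + fderiv ℝ ψ x y := by
      intro y
      simp [taylorSum, Finset.sum_range_succ]
    have h := h₂ y hy
    have h' := h₂ (-y) (by rwa [norm_neg])
    rw [hT] at h h'
    rw [norm_neg, map_neg] at h'
    have a := abs_le.1 h
    have a' := abs_le.1 h'
    norm_num at a a'
    have hK : 0 ≤ K₁ * ‖y‖ ^ 2 := by positivity
    rw [abs_le]
    constructor <;> linarith

/-- A continuous function with a unique minimizer and a gap at infinity is bounded away from its
minimum off every neighbourhood of the minimizer. -/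
theorem exists_gap_of_unique_min {d : ℕ} {f : E d → ℝ} {xs : E d} (hf : Continuous f)
    (hmin : ∀ x, x ≠ xs → f xs < f x)
    (hinf : ∃ η > 0, ∃ R : ℝ, ∀ x, R ≤ ‖x‖ → f xs + η ≤ f x) {r : ℝ} (hr : 0 < r) :
    ∃ η > 0, ∀ x, r ≤ ‖x - xs‖ → f xs + η ≤ f x := by
  obtain ⟨η, hη, R, hR⟩ := hinf
  let S : Set (E d) := Metric.closedBall 0 R ∩ {x | r ≤ ‖x - xs‖}
  have hS : IsCompact S := (isCompact_closedBall 0 R).inter_right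
    (isClosed_le continuous_const (by fun_prop))
  have hSne : ∀ x ∈ S, x ≠ xs := by
    rintro x ⟨-, hx⟩ rfl
    simp at hx
    linarith
  rcases S.eq_empty_or_nonempty with hE | hne
  · refine ⟨η, hη, fun x hx => hR x ?_⟩
    by_contra! h
    have : x ∈ S := ⟨by simpa using h.le, hx⟩
    simp [hE] at this
  · obtain ⟨x₀, hx₀, hx₀min⟩ := hS.exists_isMinOn hne hf.continuousOn
    have hpos := hmin x₀ (hSne x₀ hx₀)
    refine ⟨min η (f x₀ - f xs), lt_min hη (by linarith), fun x hx => ?_⟩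
    rcases le_total R ‖x‖ with h | h
    · linarith [hR x h, min_le_left η (f x₀ - f xs)]
    · have : x ∈ S := ⟨by simpa using h, hx⟩
      have h2 : f x₀ ≤ f x := hx₀min this
      linarith [min_le_right η (f x₀ - f xs)]

end TaylorExpansion

section Laplace

variable {d : ℕ} {f : E d → ℝ} {xs : E d}

theorem fderiv_eq_zero_of_unique_min (hmin : ∀ x, x ≠ xs → f xs < f x) : fderiv ℝ f xs = 0 := by
  refine IsLocalMin.fderiv_eq_zero (Filter.Eventually.of_forall fun x => ?_)
  rcases eq_or_ne x xs with rfl | h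
  · exact le_rfl
  · exact (hmin x h).le

theorem mul_norm_pow_le_of_opNorm {T : E d ≃L[ℝ] E d} {K τ : ℝ} (hK : 0 ≤ K) (hτ : 1 ≤ τ)
    (hT : ∀ z, ‖T z‖ ≤ τ * ‖z‖) {n : ℕ} (hn : n ≤ 4) (z : E d) :
    K * ‖T z‖ ^ n ≤ K * τ ^ 4 * ‖z‖ ^ n := by
  calc K * ‖T z‖ ^ n ≤ K * (τ * ‖z‖) ^ n := by gcongr; exact hT z
    _ = K * τ ^ n * ‖z‖ ^ n := by ring
    _ ≤ _ := by gcongr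

theorem exists_opNorm_bound (T : E d ≃L[ℝ] E d) : ∃ τ ≥ 1, ∀ z, ‖T z‖ ≤ τ * ‖z‖ := by
  refine ⟨‖(T : E d →L[ℝ] E d)‖ + 1, by simp, fun z => ?_⟩
  have := (T : E d →L[ℝ] E d).le_opNorm z
  simp only [ContinuousLinearEquiv.coe_coe] at this
  linarith [norm_nonneg z]

/-- Linear coordinates around the minimizer in which the Hessian is the identity. -/
theorem exists_normal_form (hf : ContDiff ℝ 4 f) (hmin : ∀ x, x ≠ xs → f xs < f x)
    (hinf : ∃ η > 0, ∃ R : ℝ, ∀ x, R ≤ ‖x‖ → f xs + η ≤ f x) (hpd : (hess f xs).PosDef) :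
    ∃ (T : E d ≃L[ℝ] E d) (B : Matrix (Fin d) (Fin d) ℝ), (∀ z i, T z i = ∑ j, B i j * z j) ∧
      B * B.transpose = (hess f xs)⁻¹ ∧
      |LinearMap.det ((T : E d →L[ℝ] E d) : E d →ₗ[ℝ] E d)| = 1 / √(hess f xs).det ∧
      ∃ K > 0, (∀ z, ‖z‖ ≤ 1 → |f (xs + T z) - f xs - ‖z‖ ^ 2 / 2| ≤ K * ‖z‖ ^ 3) ∧
        (∀ z, ‖z‖ ≤ 1 → |(f (xs + T z) - f xs + (f (xs + T (-z)) - f xs)) / 2 - ‖z‖ ^ 2 / 2| ≤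
          K * ‖z‖ ^ 4) ∧
        ∀ r > 0, ∃ η > 0, ∀ z, r < ‖z‖ → η ≤ f (xs + T z) - f xs := by
  obtain ⟨B, hB1, hB2, hBdet⟩ := exists_normalizing_matrix hpd
  have hdet0 : B.det ≠ 0 := by
    rw [← abs_pos, hBdet]
    have := hpd.det_pos
    positivity
  obtain ⟨T, hT, hTdet⟩ := exists_continuousLinearEquiv_of_det_ne_zero hdet0
  obtain ⟨τ, hτ, hTτ⟩ := exists_opNorm_bound T
  obtain ⟨K, hK, hKf⟩ := exists_phase_bounds hf (fderiv_eq_zero_of_unique_min hmin) τ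
  have hq : ∀ z, quadForm (hess f xs) (T z) = ‖z‖ ^ 2 := fun z => by
    rw [quadForm_comp _ B hT, hB1, quadForm_one]
  have hball : ∀ z, ‖z‖ ≤ 1 → ‖T z‖ ≤ τ := fun z hz =>
    (hTτ z).trans (mul_le_of_le_one_right (by linarith) hz)
  refine ⟨T, B, hT, hB2, by rw [hTdet, hBdet], K * τ ^ 4, by positivity, fun z hz => ?_,
    fun z hz => ?_, fun r hr => ?_⟩
  · have h := (hKf (T z) (hball z hz)).1
    rw [hq] at h
    exact h.trans (mul_norm_pow_le_of_opNorm hK.le hτ hTτ (by norm_num) z)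
  · have h := (hKf (T z) (hball z hz)).2
    rw [hq, ← map_neg] at h
    exact h.trans (mul_norm_pow_le_of_opNorm hK.le hτ hTτ (by norm_num) z)
  · obtain ⟨σ, hσ, hTσ⟩ := exists_opNorm_bound T.symm
    obtain ⟨η, hη, hgap⟩ := exists_gap_of_unique_min hf.continuous hmin hinf
      (r := r / σ) (by positivity)
    refine ⟨η, hη, fun z hz => ?_⟩
    have h1 : r / σ ≤ ‖xs + T z - xs‖ := by
      rw [add_sub_cancel_left, div_le_iff₀ (by positivity)]
      have := hTσ (T z)
      rw [T.symm_apply_apply] at this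
      linarith
    linarith [hgap _ h1]

theorem mconst_pos (hpd : (hess f xs).PosDef) {α : ℝ} (hα : 0 < α) : 0 < mconst f xs α := by
  have := hpd.det_pos
  unfold mconst
  positivity

theorem inv_mconst {α : ℝ} (hα : 0 < α) :
    (mconst f xs α)⁻¹ = 1 / √(hess f xs).det * (2 * Real.pi / α) ^ ((d : ℝ) / 2) := by
  rw [mconst, mul_inv, ← Real.inv_rpow (by positivity), inv_div, one_div]

/-- Lower bound for the partition function by Laplace's method. -/
theorem exists_partition_lower_bound (hf : ContDiff ℝ 4 f) (hmin : ∀ x, x ≠ xs → f xs < f x)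
    (hinf : ∃ η > 0, ∃ R : ℝ, ∀ x, R ≤ ‖x‖ → f xs + η ≤ f x) (hpd : (hess f xs).PosDef)
    (hint : ∀ α, 1 ≤ α → Integrable fun x => Real.exp (-α * (f x - f xs))) :
    ∃ C > 0, ∃ α₀ ≥ 1, ∀ α ≥ α₀,
      (mconst f xs α)⁻¹ * (1 - C / α) ≤ ∫ x, Real.exp (-α * (f x - f xs)) := by
  obtain ⟨T, B, hT, hB, hdet, K, hK, hG3, hG4, hGr⟩ := exists_normal_form hf hmin hinf hpd
  refine ⟨32 * K * 2 ^ ((d : ℝ) / 2), by positivity, max 1 (1 / K), le_max_left _ _,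
    fun α hα => ?_⟩
  have hα1 : 1 ≤ α := (le_max_left _ _).trans hα
  have hα0 : 0 < α := by linarith
  have hαK : 1 / K ≤ α := (le_max_right _ _).trans hα
  have h := laplace_lower_bound (d := d) (G := fun z => f (xs + T z) - f xs) hK one_pos
    (fun z hz => by linarith [(abs_le.1 (hG4 z hz)).2]) hα0
    (by rw [one_pow, mul_one]; rwa [div_le_iff₀ hK] at hαK)
    (integrable_comp_add_continuousLinearEquiv T xs (hint α hα1))
  rw [integral_comp_add_continuousLinearEquiv T xs, hdet, inv_mconst hα0, mul_assoc]
  gcongr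

theorem grad_eq_zero_of_fderiv {ψ : E d → ℝ} {x : E d} (h : fderiv ℝ ψ x = 0) : grad ψ x = 0 := by
  ext i
  simp [grad, h]

/-- Upper bound for a Laplace integral with a nonnegative amplitude. -/
theorem exists_amplitude_upper_bound (hd : 1 ≤ d) (hf : ContDiff ℝ 4 f)
    (hmin : ∀ x, x ≠ xs → f xs < f x)
    (hinf : ∃ η > 0, ∃ R : ℝ, ∀ x, R ≤ ‖x‖ → f xs + η ≤ f x) (hpd : (hess f xs).PosDef)
    {ψ : E d → ℝ} (hψ : ContDiff ℝ 2 ψ) (hψ0 : ∀ x, 0 ≤ ψ x) (hC : 0 < laplaceConst f xs ψ)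
    (hint : ∀ α, 2 ≤ α → Integrable fun x => Real.exp (-α * (f x - f xs)) * ψ x) :
    ∃ C > 0, ∃ α₀ ≥ 2, ∀ α ≥ α₀, ∫ x, Real.exp (-α * (f x - f xs)) * ψ x ≤
      (mconst f xs α)⁻¹ * ((ψ xs + laplaceConst f xs ψ / α) * (1 + C / α)) := by
  obtain ⟨T, B, hT, hB, hdet, K, hK, hG3, hG4, hGr⟩ := exists_normal_form hf hmin hinf hpd
  obtain ⟨τ, hτ, hTτ⟩ := exists_opNorm_bound T
  have hball : ∀ z, ‖z‖ ≤ 1 → ‖T z‖ ≤ τ := fun z hz =>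
    (hTτ z).trans (mul_le_of_le_one_right (by linarith) hz)
  have hint' : ∀ α, 2 ≤ α →
      Integrable fun z => Real.exp (-α * (f (xs + T z) - f xs)) * ψ (xs + T z) :=
    fun α hα => integrable_comp_add_continuousLinearEquiv T xs (hint α hα)
  have hs : 0 ≤ 1 / √(hess f xs).det := by positivity
  rcases (hψ0 xs).eq_or_lt with h0 | h0
  · have hψfd : fderiv ℝ ψ xs = 0 :=
      IsLocalMin.fderiv_eq_zero (Filter.Eventually.of_forall fun x => h0 ▸ hψ0 x)
    set M := B.transpose * hess ψ xs * B with hM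
    have htr : M.trace = ((hess f xs)⁻¹ * hess ψ xs).trace := by
      rw [hM, Matrix.trace_mul_comm, ← mul_assoc, hB]
    have hlc : laplaceConst f xs ψ = |M.trace| := by
      rw [laplaceConst, grad_eq_zero_of_fderiv hψfd, zero_dotProduct, sub_zero, htr]
    have hbound : ∀ ε > 0, ∃ r > 0, ∀ z, ‖z‖ ≤ r →
        |ψ (xs + T z) - quadForm M z / 2| ≤ ε * ‖z‖ ^ 2 := by
      intro ε hε
      obtain ⟨r, hr, h⟩ := exists_taylor_two_peano hψ xs (ε := ε / τ ^ 2) (by positivity)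
      refine ⟨r / τ, by positivity, fun z hz => ?_⟩
      rw [le_div_iff₀ (by positivity)] at hz
      have h1 := h (T z) ((hTτ z).trans (by linarith))
      rw [taylorSum_two, ← h0, hψfd, quadForm_comp _ B hT, zero_apply, zero_add, zero_add] at h1
      refine h1.trans ?_
      calc ε / τ ^ 2 * ‖T z‖ ^ 2 ≤ ε / τ ^ 2 * (τ * ‖z‖) ^ 2 := by gcongr; exact hTτ z
        _ = _ := by field_simp
    have hM0 : 0 ≤ M.trace := by
      refine le_of_forall_pos_le_add fun ε hε => ?_
      obtain ⟨r, hr, h⟩ := hbound (ε / (2 * d)) (by positivity)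
      have h1 : 0 ≤ (M + (ε / d) • (1 : Matrix (Fin d) (Fin d) ℝ)).trace :=
        trace_nonneg_of_quadForm_nonneg (quadForm_nonneg_of_ball hr fun z hz => by
          have h2 := (abs_le.1 (h z hz)).2
          have h3 : ε / (2 * d) = ε / d / 2 := by rw [mul_comm, div_mul_eq_div_div]
          rw [h3] at h2
          rw [quadForm_add_smul_one]
          linarith [hψ0 (xs + T z)])
      rw [Matrix.trace_add, Matrix.trace_smul, Matrix.trace_one, Fintype.card_fin, smul_eq_mul,
        div_mul_cancel₀ _ (by positivity)] at h1
      exact h1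
    have hMpos : 0 < M.trace := by
      rw [hlc, abs_of_nonneg hM0] at hC
      exact hC
    obtain ⟨α₀, hα₀, h⟩ := laplace_upper_bound_of_vanishing hd hK hG3 hGr
      (fun z => hψ0 (xs + T z)) hMpos
      (fun ε hε => by
        obtain ⟨r, hr, h⟩ := hbound ε hε
        exact ⟨r, hr, fun z hz => by linarith [(abs_le.1 (h z hz)).2]⟩) hint'
    refine ⟨1, one_pos, α₀, hα₀, fun α hα => ?_⟩
    have hα0 : 0 < α := by linarith
    rw [integral_comp_add_continuousLinearEquiv T xs, hdet, inv_mconst hα0, mul_assoc, ← h0,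
      zero_add, hlc, abs_of_pos hMpos]
    refine mul_le_mul_of_nonneg_left ((h α hα).trans ?_) hs
    refine mul_le_mul_of_nonneg_left (le_mul_of_one_le_right (by positivity) ?_) (by positivity)
    have : 0 ≤ 1 / α := by positivity
    linarith
  · obtain ⟨K', hK', hKψ⟩ := exists_amplitude_bounds hψ xs τ
    have hT0 : xs + T 0 = xs := by simp
    have hle : ∀ (n : ℕ) (z : E d), K * ‖z‖ ^ n ≤ (K + K' * τ ^ 4) * ‖z‖ ^ n := by
      intro n z
      gcongr
      have : 0 ≤ K' * τ ^ 4 := by positivity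
      linarith
    have hle' : ∀ n ≤ 4, ∀ z : E d, K' * ‖T z‖ ^ n ≤ (K + K' * τ ^ 4) * ‖z‖ ^ n := by
      intro n hn z
      refine (mul_norm_pow_le_of_opNorm hK'.le hτ hTτ hn z).trans ?_
      gcongr
      linarith
    obtain ⟨C, hC0, α₀, hα₀, h⟩ := laplace_upper_bound (d := d)
      (G := fun z => f (xs + T z) - f xs) (Ψ := fun z => ψ (xs + T z)) (K := K + K' * τ ^ 4)
      (by positivity) (fun z hz => (hG3 z hz).trans (hle _ z))
      (fun z hz => (hG4 z hz).trans (hle _ z)) hGr (fun z => hψ0 _)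
      (fun z hz => by
        have h1 := (hKψ (T z) (hball z hz)).1
        have h2 := hle' 1 (by norm_num) z
        rw [pow_one, pow_one] at h2
        simp only [hT0]
        exact h1.trans h2)
      (fun z hz => by
        have h1 := (hKψ (T z) (hball z hz)).2
        rw [← map_neg] at h1
        simp only [hT0]
        exact h1.trans (hle' 2 (by norm_num) z)) hint'
    simp only [hT0] at h
    refine ⟨C / ψ xs, by positivity, α₀, hα₀, fun α hα => ?_⟩
    have hα0 : 0 < α := by linarith
    rw [integral_comp_add_continuousLinearEquiv T xs, hdet, inv_mconst hα0, mul_assoc]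
    refine mul_le_mul_of_nonneg_left ((h α hα).trans ?_) hs
    refine mul_le_mul_of_nonneg_left ?_ (by positivity)
    have e : ψ xs + C / α = ψ xs * (1 + C / ψ xs / α) := by field_simp
    rw [e]
    refine mul_le_mul_of_nonneg_right ?_ (by positivity)
    have : 0 ≤ laplaceConst f xs ψ / α := by positivity
    linarith

end Laplace

section Adaptive

variable {d k : ℕ} {Ω Ω' : Type*} {mΩ : MeasurableSpace Ω} {mΩ' : MeasurableSpace Ω'}
  {P : Measure Ω} [IsProbabilityMeasure P] {T : Ω → Ω'} {X : Ω → E d} {q : Ω' → E d → ℝ}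

/-- The joint law of `T` and `X`, when `X` has the conditional density `q (T ω)` given `T`. -/
theorem map_prodMk_eq_withDensity (hT : Measurable T) (hX : Measurable X)
    (hq : Measurable (Function.uncurry q))
    (h : ∀ A B, MeasurableSet A → MeasurableSet B → P (T ⁻¹' A ∩ X ⁻¹' B) =
      ∫⁻ ω in T ⁻¹' A, (∫⁻ x in B, ENNReal.ofReal (q (T ω) x)) ∂P) :
    P.map (fun ω => (T ω, X ω)) =
      ((P.map T).prod volume).withDensity fun p => ENNReal.ofReal (q p.1 p.2) := by
  have : IsProbabilityMeasure (P.map fun ω => (T ω, X ω)) :=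
    Measure.isProbabilityMeasure_map (hT.prodMk hX).aemeasurable
  have : IsProbabilityMeasure (P.map T) := Measure.isProbabilityMeasure_map hT.aemeasurable
  have hq' : Measurable fun p : Ω' × E d => ENNReal.ofReal (q p.1 p.2) := hq.ennreal_ofReal
  refine Measure.ext_prod fun {A B} hA hB => ?_
  rw [Measure.map_apply (hT.prodMk hX) (hA.prod hB), withDensity_apply _ (hA.prod hB),
    setLIntegral_prod _ hq'.aemeasurable, setLIntegral_map hA hq'.lintegral_prod_right' hT,
    ← h A B hA hB]
  rfl

/-- One step of the adaptive sampling scheme: adding a centred importance-weighted particle. -/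
theorem integral_sq_norm_add_weighted_le (hT : Measurable T) (hX : Measurable X)
    (hq : Measurable (Function.uncurry q))
    (hlaw : P.map (fun ω => (T ω, X ω)) =
      ((P.map T).prod volume).withDensity fun p => ENNReal.ofReal (q p.1 p.2))
    {g₀ : E d → ℝ} (hg₀ : ∀ x, 0 < g₀ x) (hqg : ∀ᵐ ω ∂P, ∀ x, g₀ x ≤ q (T ω) x)
    {u : E d → E k} (hu : Measurable u) (hui : Integrable u)
    (hu2 : Integrable fun x => ‖u x‖ ^ 2 / g₀ x)
    {S : Ω' → E k} (hS : Measurable S) (hS2 : Integrable (fun ω => ‖S (T ω)‖ ^ 2) P) :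
    Integrable (fun ω => ‖S (T ω) + ((1 / q (T ω) (X ω)) • u (X ω) - ∫ x, u x)‖ ^ 2) P ∧
    ∫ ω, ‖S (T ω) + ((1 / q (T ω) (X ω)) • u (X ω) - ∫ x, u x)‖ ^ 2 ∂P ≤
      ∫ ω, ‖S (T ω)‖ ^ 2 ∂P + ∫ x, ‖u x‖ ^ 2 / g₀ x := by
  set v := ∫ x, u x with hv
  have hPT : IsProbabilityMeasure (P.map T) := Measure.isProbabilityMeasure_map hT.aemeasurable
  have hq' : Measurable fun p : Ω' × E d => ENNReal.ofReal (q p.1 p.2) := hq.ennreal_ofReal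
  have hTX : Measurable fun ω => (T ω, X ω) := hT.prodMk hX
  let y : Ω' × E d → E k := fun p => (1 / q p.1 p.2) • u p.2
  have hym : Measurable y := (hq.const_div 1).smul (hu.comp measurable_snd)
  set Y : Ω → E k := fun ω => (1 / q (T ω) (X ω)) • u (X ω) with hY
  have hYm : Measurable Y := hym.comp hTX
  have hq₀ : ∀ᵐ ω ∂P, ∀ x, 0 < q (T ω) x := hqg.mono fun ω h x => (hg₀ x).trans_le (h x)
  have hI0 : 0 ≤ ∫ x, ‖u x‖ ^ 2 / g₀ x :=
    integral_nonneg fun x => div_nonneg (sq_nonneg _) (hg₀ x).le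
  have hYl : ∫⁻ ω, ENNReal.ofReal (‖Y ω‖ ^ 2) ∂P ≤ ENNReal.ofReal (∫ x, ‖u x‖ ^ 2 / g₀ x) := by
    have hm : Measurable fun p => ENNReal.ofReal (‖y p‖ ^ 2) := by fun_prop
    calc ∫⁻ ω, ENNReal.ofReal (‖Y ω‖ ^ 2) ∂P
        = ∫⁻ p, ENNReal.ofReal (‖y p‖ ^ 2) ∂(P.map fun ω => (T ω, X ω)) :=
          (lintegral_map hm hTX).symm
      _ = ∫⁻ ω, (∫⁻ x, ENNReal.ofReal (q (T ω) x) * ENNReal.ofReal (‖y (T ω, x)‖ ^ 2)) ∂P := by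
          rw [hlaw, lintegral_withDensity_eq_lintegral_mul _ hq' hm,
            lintegral_prod _ (hq'.mul hm).aemeasurable,
            lintegral_map (hq'.mul hm).lintegral_prod_right' hT]
          rfl
      _ ≤ ∫⁻ _ω, ENNReal.ofReal (∫ x, ‖u x‖ ^ 2 / g₀ x) ∂P := by
          refine lintegral_mono_ae (hqg.mono fun ω h => ?_)
          rw [ofReal_integral_eq_lintegral_ofReal hu2
            (Filter.Eventually.of_forall fun x => div_nonneg (sq_nonneg _) (hg₀ x).le)]
          refine lintegral_mono fun x => ?_
          have hqx : 0 < q (T ω) x := (hg₀ x).trans_le (h x)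
          rw [← ENNReal.ofReal_mul hqx.le]
          refine ENNReal.ofReal_le_ofReal ?_
          have e : q (T ω) x * ‖y (T ω, x)‖ ^ 2 = ‖u x‖ ^ 2 / q (T ω) x := by
            simp only [y, norm_smul, norm_div, norm_one, Real.norm_eq_abs, abs_of_pos hqx]
            field_simp
          rw [e]
          exact div_le_div_of_nonneg_left (sq_nonneg _) (hg₀ x) (h x)
      _ = _ := by simp
  have hY2 : Integrable (fun ω => ‖Y ω‖ ^ 2) P := by
    refine ⟨by fun_prop, ?_⟩
    rw [hasFiniteIntegral_iff_ofReal (Filter.Eventually.of_forall fun ω => sq_nonneg _)]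
    exact hYl.trans_lt ENNReal.ofReal_lt_top
  have hYint : ∫ ω, ‖Y ω‖ ^ 2 ∂P ≤ ∫ x, ‖u x‖ ^ 2 / g₀ x := by
    rw [integral_eq_lintegral_of_nonneg_ae (Filter.Eventually.of_forall fun ω => sq_nonneg _)
      (by fun_prop)]
    exact ENNReal.toReal_le_of_le_ofReal hI0 hYl
  let R : Ω' → E k := fun ω' => S ω' - v
  have hRm : Measurable R := hS.sub_const v
  have hR2 : Integrable (fun ω => ‖R (T ω)‖ ^ 2) P := by
    refine ((hS2.const_mul 2).add (integrable_const (2 * ‖v‖ ^ 2))).mono'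
      ((hRm.comp hT).norm.pow_const 2).aestronglyMeasurable (Filter.Eventually.of_forall fun ω => ?_)
    rw [Real.norm_eq_abs, abs_of_nonneg (sq_nonneg _)]
    have h1 : ‖R (T ω)‖ ≤ ‖S (T ω)‖ + ‖v‖ := norm_sub_le _ _
    have h2 : ‖R (T ω)‖ ^ 2 ≤ (‖S (T ω)‖ + ‖v‖) ^ 2 := by gcongr
    simp only [Pi.add_apply]
    nlinarith [sq_nonneg (‖S (T ω)‖ - ‖v‖)]
  have hSn : Integrable (fun ω => ‖S (T ω)‖) P := by
    refine (hS2.add (integrable_const 1)).mono' (hS.comp hT).norm.aestronglyMeasurable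
      (Filter.Eventually.of_forall fun ω => ?_)
    rw [norm_norm]
    simp only [Pi.add_apply]
    nlinarith [sq_nonneg (‖S (T ω)‖ - 1)]
  have hSi : Integrable (fun ω => S (T ω)) P :=
    (integrable_norm_iff (hS.comp hT).aestronglyMeasurable).1 hSn
  have hRv : Integrable (fun ω => inner ℝ (R (T ω)) v) P :=
    (hSi.sub (integrable_const v)).inner_const v
  have hRY : Integrable (fun ω => inner ℝ (R (T ω)) (Y ω)) P := by
    refine (hR2.add hY2).mono' ((hRm.comp hT).inner hYm).aestronglyMeasurable
      (Filter.Eventually.of_forall fun ω => ?_)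
    refine (norm_inner_le_norm _ _).trans ?_
    simp only [Pi.add_apply]
    nlinarith [sq_nonneg (‖R (T ω)‖ - ‖Y ω‖), sq_nonneg ‖R (T ω)‖, sq_nonneg ‖Y ω‖]
  have hcross : ∫ ω, inner ℝ (R (T ω)) (Y ω) ∂P = ∫ ω, inner ℝ (R (T ω)) v ∂P := by
    let h : Ω' × E d → ℝ := fun p => inner ℝ (R p.1) (y p)
    have hm : Measurable h := (hRm.comp measurable_fst).inner hym
    have hqlt : ∀ᵐ p ∂((P.map T).prod (volume : Measure (E d))), ENNReal.ofReal (q p.1 p.2) < ⊤ :=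
      Filter.Eventually.of_forall fun _ => ENNReal.ofReal_lt_top
    have hi : Integrable h (((P.map T).prod volume).withDensity
        fun p => ENNReal.ofReal (q p.1 p.2)) := by
      rw [← hlaw, integrable_map_measure hm.aestronglyMeasurable hTX.aemeasurable]
      exact hRY
    have hi2 := (integrable_withDensity_iff_integrable_smul' hq' hqlt).1 hi
    calc ∫ ω, inner ℝ (R (T ω)) (Y ω) ∂P
        = ∫ p, h p ∂(P.map fun ω => (T ω, X ω)) :=
          (integral_map hTX.aemeasurable hm.aestronglyMeasurable).symm
      _ = ∫ ω', (∫ x, (ENNReal.ofReal (q ω' x)).toReal • h (ω', x)) ∂(P.map T) := by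
          rw [hlaw, integral_withDensity_eq_integral_toReal_smul hq' hqlt, integral_prod _ hi2]
      _ = ∫ ω, (∫ x, (ENNReal.ofReal (q (T ω) x)).toReal • h (T ω, x)) ∂P :=
          integral_map hT.aemeasurable hi2.integral_prod_left.aestronglyMeasurable
      _ = ∫ ω, inner ℝ (R (T ω)) v ∂P := by
          refine integral_congr_ae (hq₀.mono fun ω hω => ?_)
          simp only
          rw [hv, ← integral_inner hui]
          refine integral_congr_ae (Filter.Eventually.of_forall fun x => ?_)
          simp only [h, y]
          rw [ENNReal.toReal_ofReal (hω x).le, inner_smul_right, smul_eq_mul]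
          have := (hω x).ne'
          field_simp
  have hexp : ∀ ω, ‖S (T ω) + (Y ω - v)‖ ^ 2 =
      ‖R (T ω)‖ ^ 2 + 2 * inner ℝ (R (T ω)) (Y ω) + ‖Y ω‖ ^ 2 := by
    intro ω
    rw [← norm_add_sq_real]
    congr 2
    simp only [R]
    abel
  have hexp2 : ∀ ω, ‖S (T ω)‖ ^ 2 = ‖R (T ω)‖ ^ 2 + 2 * inner ℝ (R (T ω)) v + ‖v‖ ^ 2 := by
    intro ω
    rw [← norm_add_sq_real]
    congr 2
    simp [R]
  have hRYi : Integrable (fun ω => ‖R (T ω)‖ ^ 2 + 2 * inner ℝ (R (T ω)) (Y ω)) P :=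
    hR2.add (hRY.const_mul 2)
  have hRvi : Integrable (fun ω => ‖R (T ω)‖ ^ 2 + 2 * inner ℝ (R (T ω)) v) P :=
    hR2.add (hRv.const_mul 2)
  refine ⟨(hRYi.add hY2).congr (Filter.Eventually.of_forall fun ω => (hexp ω).symm), ?_⟩
  have e1 : ∫ ω, ‖S (T ω) + (Y ω - v)‖ ^ 2 ∂P =
      ∫ ω, ‖R (T ω)‖ ^ 2 ∂P + 2 * ∫ ω, inner ℝ (R (T ω)) (Y ω) ∂P + ∫ ω, ‖Y ω‖ ^ 2 ∂P := by
    simp_rw [hexp]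
    rw [integral_add hRYi hY2, integral_add hR2 (hRY.const_mul 2),
      integral_const_mul]
  have e2 : ∫ ω, ‖S (T ω)‖ ^ 2 ∂P =
      ∫ ω, ‖R (T ω)‖ ^ 2 ∂P + 2 * ∫ ω, inner ℝ (R (T ω)) v ∂P + ‖v‖ ^ 2 := by
    simp_rw [hexp2]
    rw [integral_add hRvi (integrable_const _),
      integral_add hR2 (hRv.const_mul 2), integral_const_mul]
    simp
  rw [e1, e2, hcross]
  linarith [sq_nonneg ‖v‖]

end Adaptive

section AdaptiveSampling

variable {d k : ℕ} {Ω : Type*} {mΩ : MeasurableSpace Ω} {P : Measure Ω}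
  {F : Filtration ℕ mΩ} {𝒬 : Set (E d → ℝ)} {X : ℕ → Ω → E d} {q : ℕ → Ω → E d → ℝ}
  {q₀ : E d → ℝ}

/-- The information available when the `(n + 1)`-st particle is drawn. -/
abbrev pastAlgebra (F : Filtration ℕ mΩ) : ℕ → MeasurableSpace Ω
  | 0 => ⊥
  | n + 1 => F (n + 1)

theorem pastAlgebra_le (F : Filtration ℕ mΩ) (n : ℕ) : pastAlgebra F n ≤ mΩ := by
  cases n with
  | zero => exact bot_le
  | succ n => exact F.le _

theorem pastAlgebra_le_succ (F : Filtration ℕ mΩ) (n : ℕ) :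
    pastAlgebra F n ≤ pastAlgebra F (n + 1) := by
  cases n with
  | zero => exact bot_le
  | succ n => exact F.mono (Nat.le_succ _)

theorem IsDensity.integrable {p : E d → ℝ} (hp : IsDensity p) : Integrable p := by
  refine ⟨hp.1.aestronglyMeasurable, ?_⟩
  rw [hasFiniteIntegral_iff_ofReal (Filter.Eventually.of_forall hp.2.1), hp.2.2]
  exact ENNReal.one_lt_top

theorem IsAdaptiveSampling.ae_mem (h : IsAdaptiveSampling P F 𝒬 X q q₀) (n : ℕ) :
    ∀ᵐ ω ∂P, q n ω ∈ 𝒬 := by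
  cases n with
  | zero => exact Filter.Eventually.of_forall fun ω => by rw [h.init_eq]; exact h.init_mem
  | succ n => exact h.density_mem _ (Nat.succ_pos n)

theorem IsAdaptiveSampling.measurable_density (h : IsAdaptiveSampling P F 𝒬 X q q₀)
    (h𝒬 : ∀ p ∈ 𝒬, IsDensity p) (n : ℕ) :
    @Measurable (Ω × E d) ℝ ((pastAlgebra F n).prod inferInstance) _ (Function.uncurry (q n)) := by
  cases n with
  | zero =>
    have e : Function.uncurry (q 0) = q₀ ∘ Prod.snd := by
      ext ⟨ω, x⟩
      simp [h.init_eq]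
    rw [e]
    exact (h𝒬 q₀ h.init_mem).1.comp (@measurable_snd _ _ (pastAlgebra F 0) _)
  | succ n => exact h.density_measurable _ (Nat.succ_pos n)

theorem IsAdaptiveSampling.measurable_particle (h : IsAdaptiveSampling P F 𝒬 X q q₀) (n : ℕ) :
    Measurable (X (n + 1)) :=
  (h.adapted n).mono (F.le _) le_rfl

/-- The conditional law of the next particle, tested on rectangles. -/
theorem IsAdaptiveSampling.measure_inter [IsProbabilityMeasure P]
    (h : IsAdaptiveSampling P F 𝒬 X q q₀)
    (h𝒬 : ∀ p ∈ 𝒬, IsDensity p) (n : ℕ) {A : Set Ω} {B : Set (E d)}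
    (hA : MeasurableSet[pastAlgebra F n] A) (hB : MeasurableSet B) :
    P (A ∩ X (n + 1) ⁻¹' B) =
      ∫⁻ ω in A, (∫⁻ x in B, ENNReal.ofReal (q n ω x)) ∂P := by
  have hXm := h.measurable_particle n
  cases n with
  | zero =>
    rcases MeasurableSpace.measurableSet_bot_iff.1 hA with rfl | rfl
    · simp
    · simp only [Set.univ_inter, h.init_eq]
      rw [← Measure.map_apply hXm hB, h.law_one, withDensity_apply _ hB]
      simp
  | succ n =>
    have hA' : MeasurableSet[F (n + 1)] A := hA
    have hAm : MeasurableSet A := F.le _ _ hA'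
    have hXB : MeasurableSet (X (n + 1 + 1) ⁻¹' B) := hXm hB
    have hcl := h.cond_law (n + 1) (Nat.succ_pos n) B hB
    have hind : Integrable ((X (n + 1 + 1) ⁻¹' B).indicator fun _ => (1 : ℝ)) P :=
      (integrable_const 1).indicator hXB
    have h1 : ∫ ω in A, (∫ x in B, q (n + 1) ω x) ∂P = P.real (A ∩ X (n + 1 + 1) ⁻¹' B) := by
      rw [← setIntegral_congr_ae hAm (hcl.mono fun ω hω _ => hω),
        setIntegral_condExp (F.le _) hind hA', integral_indicator hXB,
        Measure.restrict_restrict hXB, Set.inter_comm]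
      simp
    have hdens : ∀ᵐ ω ∂P, IsDensity (q (n + 1) ω) :=
      (h.ae_mem (n + 1)).mono fun ω hω => h𝒬 _ hω
    have h2 : ∀ᵐ ω ∂P, ENNReal.ofReal (∫ x in B, q (n + 1) ω x) =
        ∫⁻ x in B, ENNReal.ofReal (q (n + 1) ω x) := hdens.mono fun ω hω =>
      ofReal_integral_eq_lintegral_ofReal hω.integrable.integrableOn
        (Filter.Eventually.of_forall hω.2.1)
    rw [← ofReal_measureReal, ← h1, ofReal_integral_eq_lintegral_ofReal]
    · exact lintegral_congr_ae (ae_restrict_of_ae h2)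
    · exact (integrable_condExp.congr hcl).integrableOn
    · exact ae_restrict_of_ae (hdens.mono fun ω hω => integral_nonneg hω.2.1)

/-- The importance-weighted particle with index `n + 1`. -/
noncomputable def weightedParticle (X : ℕ → Ω → E d) (q : ℕ → Ω → E d → ℝ) (u : E d → E k) (n : ℕ)
    (ω : Ω) : E k :=
  (1 / q n ω (X (n + 1) ω)) • u (X (n + 1) ω)

theorem IsAdaptiveSampling.measurable_weightedParticle (h : IsAdaptiveSampling P F 𝒬 X q q₀)
    (h𝒬 : ∀ p ∈ 𝒬, IsDensity p) {u : E d → E k} (hu : Measurable u) (n : ℕ) :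
    Measurable[pastAlgebra F (n + 1)] (weightedParticle X q u n) := by
  have hX : Measurable[pastAlgebra F (n + 1)] (X (n + 1)) := h.adapted n
  have hid : @Measurable Ω Ω (pastAlgebra F (n + 1)) (pastAlgebra F n) id :=
    measurable_id'' (pastAlgebra_le_succ F n)
  have hpair := @Measurable.prodMk _ (pastAlgebra F (n + 1)) _ _ (pastAlgebra F n) _ _ _ hid hX
  exact (((h.measurable_density h𝒬 n).comp hpair).const_div 1).smul (hu.comp hX)

/-- The second moment of the sum of the centred weighted particles. -/
theorem IsAdaptiveSampling.integral_sq_norm_sum_le [IsProbabilityMeasure P]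
    (h : IsAdaptiveSampling P F 𝒬 X q q₀)
    (h𝒬 : ∀ p ∈ 𝒬, IsDensity p) {g₀ : E d → ℝ} (hg₀ : ∀ x, 0 < g₀ x)
    (hg : ∀ p ∈ 𝒬, ∀ x, g₀ x ≤ p x) {u : E d → E k} (hu : Measurable u) (hui : Integrable u)
    (hu2 : Integrable fun x => ‖u x‖ ^ 2 / g₀ x) (n : ℕ) :
    (Measurable[pastAlgebra F n] fun ω =>
      ∑ i ∈ Finset.range n, (weightedParticle X q u i ω - ∫ x, u x)) ∧
    Integrable (fun ω =>
      ‖∑ i ∈ Finset.range n, (weightedParticle X q u i ω - ∫ x, u x)‖ ^ 2) P ∧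
    ∫ ω, ‖∑ i ∈ Finset.range n, (weightedParticle X q u i ω - ∫ x, u x)‖ ^ 2 ∂P ≤
      n * ∫ x, ‖u x‖ ^ 2 / g₀ x := by
  induction n with
  | zero => simp
  | succ n ih =>
    obtain ⟨hm, hi, hle⟩ := ih
    simp only [Finset.sum_range_succ]
    have hid : @Measurable Ω Ω mΩ (pastAlgebra F n) id := measurable_id'' (pastAlgebra_le F n)
    have hlaw := @map_prodMk_eq_withDensity d Ω Ω mΩ (pastAlgebra F n) P _ id (X (n + 1)) (q n)
      hid (h.measurable_particle n) (h.measurable_density h𝒬 n)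
      fun A B hA hB => h.measure_inter h𝒬 n hA hB
    have hstep := @integral_sq_norm_add_weighted_le d k Ω Ω mΩ (pastAlgebra F n) P _ id (X (n + 1))
      (q n) hid (h.measurable_particle n) (h.measurable_density h𝒬 n) hlaw g₀ hg₀
      ((h.ae_mem n).mono fun ω hω => hg _ hω) u hu hui hu2 _ hm hi
    refine ⟨?_, hstep.1, hstep.2.trans ?_⟩
    · have hm' := hm.mono (pastAlgebra_le_succ F n) le_rfl
      exact hm'.add ((h.measurable_weightedParticle h𝒬 hu n).sub_const _)
    · simp only [id]
      push_cast
      linarith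

end AdaptiveSampling

section MeanSquareError

variable {d k : ℕ} {f : E d → ℝ} {xs : E d}

theorem mconst_two_mul {α : ℝ} (hα : 0 < α) :
    mconst f xs (2 * α) = 2 ^ ((d : ℝ) / 2) * mconst f xs α := by
  rw [mconst, mconst, mul_div_assoc, Real.mul_rpow (by norm_num) (by positivity)]
  ring

theorem exp_neg_mul_gap_le (hmin : ∀ x, f xs ≤ f x) {α β : ℝ} (h : β ≤ α) (x : E d) :
    Real.exp (-α * (f x - f xs)) ≤ Real.exp (-β * (f x - f xs)) := by
  refine Real.exp_le_exp.2 ?_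
  nlinarith [hmin x]

/-- The ratio of the two Laplace bounds. -/
theorem div_sq_le_of_laplace_bounds {m N Z c s a b α : ℝ} (hm : 0 < m) (hs : 0 < s) (hc : 0 ≤ c)
    (ha : 0 ≤ a) (hb : 0 ≤ b) (hα : 1 ≤ α) (hbα : 2 * b ≤ α)
    (hN : N ≤ (s * m)⁻¹ * (c * (1 + a / α))) (hZ : m⁻¹ * (1 - b / α) ≤ Z) :
    N / Z ^ 2 ≤ s⁻¹ * m * c * (1 + (a + 6 * b + 6 * a * b) / α) := by
  have hα0 : 0 < α := by linarith
  set t := b / α with ht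
  have ht0 : 0 ≤ t := by positivity
  have ht1 : t ≤ 1 / 2 := by rw [ht, div_le_iff₀ hα0]; linarith
  have hlow : 0 < m⁻¹ * (1 - t) := mul_pos (by positivity) (by linarith)
  have hZ0 : 0 < Z := hlow.trans_le hZ
  have haα : 0 ≤ a / α := by positivity
  have h1 : 1 ≤ (1 - t) ^ 2 * (1 + 6 * t) := by
    nlinarith [mul_nonneg ht0 (mul_nonneg (by linarith : (0:ℝ) ≤ 1 - 2 * t)
      (by linarith : (0:ℝ) ≤ 4 - 3 * t))]
  have h2 : (1 + a / α) * (1 + 6 * t) ≤ 1 + (a + 6 * b + 6 * a * b) / α := by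
    have e : (1 + a / α) * (1 + 6 * t) = 1 + (a + 6 * b + 6 * a * b * (1 / α)) / α := by
      rw [ht]; field_simp; ring
    have h3 : 1 / α ≤ 1 := by rw [div_le_one hα0]; exact hα
    have h4 : 6 * a * b * (1 / α) ≤ 6 * a * b := mul_le_of_le_one_right (by positivity) h3
    rw [e]
    gcongr
  rw [div_le_iff₀ (by positivity)]
  calc N ≤ (s * m)⁻¹ * (c * (1 + a / α)) * 1 := by rw [mul_one]; exact hN
    _ ≤ (s * m)⁻¹ * (c * (1 + a / α)) * ((1 - t) ^ 2 * (1 + 6 * t)) := by gcongr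
    _ = s⁻¹ * m * c * ((1 + a / α) * (1 + 6 * t)) * (m⁻¹ * (1 - t)) ^ 2 := by
        field_simp
    _ ≤ _ := by gcongr

theorem Zc_eq (f : E d → ℝ) (xs : E d) (α : ℝ) :
    Zc f α = Real.exp (-α * f xs) * ∫ x, Real.exp (-α * (f x - f xs)) := by
  rw [Zc, ← integral_const_mul]
  congr 1
  ext x
  rw [← Real.exp_add]
  congr 1
  ring

theorem exp_div_Zc (f : E d → ℝ) (xs : E d) (α : ℝ) (x : E d) :
    Real.exp (-α * f x) / Zc f α =
      Real.exp (-α * (f x - f xs)) / ∫ x, Real.exp (-α * (f x - f xs)) := by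
  have e : Real.exp (-α * f x) = Real.exp (-α * f xs) * Real.exp (-α * (f x - f xs)) := by
    rw [← Real.exp_add]
    congr 1
    ring
  rw [Zc_eq f xs, e, mul_div_mul_left _ _ (Real.exp_pos _).ne']

/-- The test function weighted by the Gibbs density. -/
noncomputable def gibbsWeighted (f : E d → ℝ) (α : ℝ) (φ : E d → E k) (x : E d) : E k :=
  (Real.exp (-α * f x) / Zc f α) • φ x

theorem Zc_nonneg (f : E d → ℝ) (α : ℝ) : 0 ≤ Zc f α :=
  integral_nonneg fun _ => (Real.exp_pos _).le

theorem integrable_gibbs_iff (hf : Measurable f) (α : ℝ) (φ : E d → E k) :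
    Integrable φ (gibbs f α) ↔ Integrable (gibbsWeighted f α φ) := by
  have hm : Measurable fun x => ENNReal.ofReal (Real.exp (-α * f x) / Zc f α) := by fun_prop
  rw [gibbs, integrable_withDensity_iff_integrable_smul' hm
    (Filter.Eventually.of_forall fun _ => ENNReal.ofReal_lt_top)]
  refine integrable_congr (Filter.Eventually.of_forall fun x => ?_)
  simp only [gibbsWeighted]
  rw [ENNReal.toReal_ofReal (div_nonneg (Real.exp_pos _).le (Zc_nonneg f α))]

theorem integral_gibbs (hf : Measurable f) (α : ℝ) (φ : E d → E k) :
    ∫ x, φ x ∂(gibbs f α) = ∫ x, gibbsWeighted f α φ x := by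
  have hm : Measurable fun x => ENNReal.ofReal (Real.exp (-α * f x) / Zc f α) := by fun_prop
  rw [gibbs, integral_withDensity_eq_integral_toReal_smul hm
    (Filter.Eventually.of_forall fun _ => ENNReal.ofReal_lt_top)]
  refine integral_congr_ae (Filter.Eventually.of_forall fun x => ?_)
  simp only [gibbsWeighted]
  rw [ENNReal.toReal_ofReal (div_nonneg (Real.exp_pos _).le (Zc_nonneg f α))]

theorem estimator_sub_eq {Ω : Type*} (f : E d → ℝ) (α : ℝ) (φ : E d → E k) {n : ℕ} (hn : 1 ≤ n)
    (X : ℕ → Ω → E d) (q : ℕ → Ω → E d → ℝ) (ω : Ω) (v : E k) :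
    estimator f α φ n X q ω - v = (n : ℝ)⁻¹ •
      ∑ i ∈ Finset.range n, (weightedParticle X q (gibbsWeighted f α φ) i ω - v) := by
  have hn0 : (n : ℝ) ≠ 0 := by positivity
  rw [Finset.sum_sub_distrib, smul_sub, Finset.sum_const, Finset.card_range, ← Nat.cast_smul_eq_nsmul ℝ,
    smul_smul, inv_mul_cancel₀ hn0, one_smul, estimator, Finset.smul_sum, Finset.smul_sum]
  congr 1
  refine Finset.sum_congr rfl fun i _ => ?_
  simp only [weightedParticle, gibbsWeighted, smul_smul]
  congr 1
  simp only [div_eq_mul_inv, mul_inv]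
  ring

theorem integrable_exp_gap (hf : Measurable f) (hmin : ∀ x, f xs ≤ f x)
    (hfint : Integrable fun x => Real.exp (-f x)) {α : ℝ} (hα : 1 ≤ α) :
    Integrable fun x => Real.exp (-α * (f x - f xs)) := by
  refine (hfint.const_mul (Real.exp (f xs))).mono' (by fun_prop)
    (Filter.Eventually.of_forall fun x => ?_)
  rw [Real.norm_eq_abs, Real.abs_exp, ← Real.exp_add]
  refine (exp_neg_mul_gap_le hmin hα x).trans (le_of_eq ?_)
  congr 1
  ring

theorem integrable_exp_gap_mul_sq_div (hf : Measurable f) (hmin : ∀ x, f xs ≤ f x)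
    {φ : E d → E k} {g₀ : E d → ℝ} (hg₀pos : ∀ x, 0 < g₀ x)
    (hdom : ∃ c₀ > 0, ∀ y, Real.exp (-(f y - f xs)) ≤ c₀ * g₀ y)
    (hφ2 : Integrable fun y => Real.exp (-(f y - f xs)) * ‖φ y‖ ^ 2)
    (hm : Measurable fun x => ‖φ x‖ ^ 2 / g₀ x) {α : ℝ} (hα : 2 ≤ α) :
    Integrable fun x => Real.exp (-α * (f x - f xs)) * (‖φ x‖ ^ 2 / g₀ x) := by
  obtain ⟨c₀, hc₀, hdom⟩ := hdom
  refine (hφ2.const_mul c₀).mono' (by fun_prop) (Filter.Eventually.of_forall fun x => ?_)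
  have hg := hg₀pos x
  rw [Real.norm_eq_abs, abs_of_nonneg (by positivity), ← mul_div_assoc, div_le_iff₀ hg]
  have h2 : Real.exp (-2 * (f x - f xs)) =
      Real.exp (-(f x - f xs)) * Real.exp (-(f x - f xs)) := by
    rw [← Real.exp_add]; congr 1; ring
  calc Real.exp (-α * (f x - f xs)) * ‖φ x‖ ^ 2
      ≤ Real.exp (-(f x - f xs)) * Real.exp (-(f x - f xs)) * ‖φ x‖ ^ 2 := by
        rw [← h2]
        exact mul_le_mul_of_nonneg_right (exp_neg_mul_gap_le hmin hα x) (by positivity)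
    _ ≤ Real.exp (-(f x - f xs)) * (c₀ * g₀ x) * ‖φ x‖ ^ 2 := by gcongr; exact hdom x
    _ = _ := by ring

theorem integrable_gibbsWeighted (hf : Measurable f) (hmin : ∀ x, f xs ≤ f x)
    (hfint : Integrable fun x => Real.exp (-f x)) {φ : E d → E k} (hφ : Measurable φ)
    (hφ2 : Integrable fun y => Real.exp (-(f y - f xs)) * ‖φ y‖ ^ 2) {α : ℝ} (hα : 1 ≤ α) :
    Integrable (gibbsWeighted f α φ) := by
  have h1 : Integrable fun x => Real.exp (-α * (f x - f xs)) • φ x := by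
    refine ((integrable_exp_gap hf hmin hfint le_rfl).add hφ2).mono'
      (Measurable.aestronglyMeasurable (by fun_prop)) (Filter.Eventually.of_forall fun x => ?_)
    rw [norm_smul, Real.norm_eq_abs, Real.abs_exp]
    have e : Real.exp (-1 * (f x - f xs)) = Real.exp (-(f x - f xs)) := by rw [neg_one_mul]
    have e2 := exp_neg_mul_gap_le hmin hα x
    simp only [Pi.add_apply]
    rw [e] at e2 ⊢
    calc _ ≤ Real.exp (-(f x - f xs)) * (1 + ‖φ x‖ ^ 2) := by
          gcongr
          nlinarith [sq_nonneg (‖φ x‖ - 1)]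
      _ = _ := by ring
  refine (h1.smul (∫ x, Real.exp (-α * (f x - f xs)))⁻¹).congr
    (Filter.Eventually.of_forall fun x => ?_)
  simp only [gibbsWeighted, Pi.smul_apply]
  rw [exp_div_Zc f xs, smul_smul, div_eq_inv_mul]

theorem sq_norm_gibbsWeighted_div (f : E d → ℝ) (xs : E d) (α : ℝ) (φ : E d → E k) (g₀ : E d → ℝ)
    (x : E d) :
    ‖gibbsWeighted f α φ x‖ ^ 2 / g₀ x = Real.exp (-(2 * α) * (f x - f xs)) * (‖φ x‖ ^ 2 / g₀ x) /
      (∫ x, Real.exp (-α * (f x - f xs))) ^ 2 := by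
  have e : Real.exp (-(2 * α) * (f x - f xs)) = Real.exp (-α * (f x - f xs)) ^ 2 := by
    rw [← Real.exp_nat_mul]; congr 1; push_cast; ring
  rw [gibbsWeighted, exp_div_Zc f xs, norm_smul, mul_pow, Real.norm_eq_abs, sq_abs, e]
  ring

end MeanSquareError

end LISO

theorem stmt14 {d k : ℕ} (hd : 1 ≤ d)
    (f : LISO.E d → ℝ) (xs : LISO.E d)
    (hf : ContDiff ℝ 4 f)
    (hmin : ∀ x, x ≠ xs → f xs < f x)
    (hinf : ∃ η > 0, ∃ R : ℝ, ∀ x, R ≤ ‖x‖ → f xs + η ≤ f x)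
    (hpd : (LISO.hess f xs).PosDef)
    (hfint : Integrable fun x => Real.exp (-f x))
    (φ : LISO.E d → LISO.E k) (hφmeas : Measurable φ)
    (g₀ : LISO.E d → ℝ) (hg₀pos : ∀ x, 0 < g₀ x)
    (hdom : ∃ c₀ > 0, ∀ y, Real.exp (-(f y - f xs)) ≤ c₀ * g₀ y)
    (hφ2 : Integrable fun y => Real.exp (-(f y - f xs)) * ‖φ y‖ ^ 2)
    (hr1 : ContDiff ℝ 2 fun x => ‖φ x‖ ^ 2 / g₀ x)
    (hr2 : ContDiff ℝ 2 fun x => ‖φ x - φ xs‖ ^ 2 / g₀ x)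
    (hr3 : ContDiff ℝ 2 fun x => 1 / g₀ x)
    (hC1 : 0 < LISO.laplaceConst f xs fun x => ‖φ x‖ ^ 2 / g₀ x)
    (hC2 : 0 < LISO.laplaceConst f xs fun x => ‖φ x - φ xs‖ ^ 2 / g₀ x)
    (hC3 : 0 < LISO.laplaceConst f xs fun x => 1 / g₀ x) :
    ∃ C₁ > (0 : ℝ), ∃ αt > (1 : ℝ),
      ∀ 𝒬 : Set (LISO.E d → ℝ),
        (∀ p ∈ 𝒬, LISO.IsDensity p) →
        (∀ p ∈ 𝒬, ∀ x, g₀ x ≤ p x) →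
        (⨆ p ∈ 𝒬, ∫⁻ y, ENNReal.ofReal (‖φ y‖ ^ 4 * p y)) < ⊤ →
      ∀ (Ω : Type*) (mΩ : MeasurableSpace Ω) (P : Measure Ω) (_ : IsProbabilityMeasure P)
        (F : Filtration ℕ mΩ) (X : ℕ → Ω → LISO.E d) (q : ℕ → Ω → LISO.E d → ℝ)
        (q₀ : LISO.E d → ℝ),
        LISO.IsAdaptiveSampling P F 𝒬 X q q₀ →
      ∀ α > αt, ∀ n : ℕ, 1 ≤ n →
        Integrable φ (LISO.gibbs f α) ∧
        Integrable (fun ω =>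
          ‖LISO.estimator f α φ n X q ω - ∫ x, φ x ∂(LISO.gibbs f α)‖ ^ 2) P ∧
        ∫ ω, ‖LISO.estimator f α φ n X q ω - ∫ x, φ x ∂(LISO.gibbs f α)‖ ^ 2 ∂P ≤
          (n : ℝ)⁻¹ * (2 : ℝ) ^ (-(d : ℝ) / 2) * LISO.mconst f xs α *
            (‖φ xs‖ ^ 2 / g₀ xs +
              LISO.laplaceConst f xs (fun x => ‖φ x‖ ^ 2 / g₀ x) / (2 * α)) *
            (1 + C₁ / α) := by
  have hmin' : ∀ x, f xs ≤ f x := fun x => by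
    rcases eq_or_ne x xs with rfl | h
    exacts [le_rfl, (hmin x h).le]
  have hfm : Measurable f := hf.continuous.measurable
  have hψm : Measurable fun x => ‖φ x‖ ^ 2 / g₀ x := hr1.continuous.measurable
  have hψ0 : ∀ x, 0 ≤ ‖φ x‖ ^ 2 / g₀ x := fun x => div_nonneg (sq_nonneg _) (hg₀pos x).le
  have hψint : ∀ α, 2 ≤ α →
      Integrable fun x => Real.exp (-α * (f x - f xs)) * (‖φ x‖ ^ 2 / g₀ x) := fun α hα =>
    LISO.integrable_exp_gap_mul_sq_div hfm hmin' hg₀pos hdom hφ2 hψm hα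
  obtain ⟨b, hb, αL, hαL, hL⟩ := LISO.exists_partition_lower_bound hf hmin hinf hpd
    fun α hα => LISO.integrable_exp_gap hfm hmin' hfint hα
  obtain ⟨a, ha, αU, hαU, hU⟩ := LISO.exists_amplitude_upper_bound hd hf hmin hinf hpd hr1 hψ0 hC1
    hψint
  refine ⟨a / 2 + 6 * b + 6 * (a / 2) * b, by positivity, αL + αU + 2 * b, by linarith, ?_⟩
  intro 𝒬 h𝒬 hg _ Ω mΩ P hP F X q q₀ hA α hα n hn
  have hα0 : 0 < α := by linarith
  set Z := ∫ x, Real.exp (-α * (f x - f xs)) with hZ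
  have hum : Measurable (LISO.gibbsWeighted f α φ) :=
    ((Real.measurable_exp.comp (hfm.const_mul (-α))).div_const _).smul hφmeas
  have hui := LISO.integrable_gibbsWeighted hfm hmin' hfint hφmeas hφ2 (α := α) (by linarith)
  have hu2e := LISO.sq_norm_gibbsWeighted_div f xs α φ g₀
  have hu2 : Integrable fun x => ‖LISO.gibbsWeighted f α φ x‖ ^ 2 / g₀ x := by
    simp_rw [hu2e]
    exact (hψint (2 * α) (by linarith)).div_const _
  have hI : ∫ x, ‖LISO.gibbsWeighted f α φ x‖ ^ 2 / g₀ x ≤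
      (2 ^ ((d : ℝ) / 2))⁻¹ * LISO.mconst f xs α * (‖φ xs‖ ^ 2 / g₀ xs +
        LISO.laplaceConst f xs (fun x => ‖φ x‖ ^ 2 / g₀ x) / (2 * α)) *
          (1 + (a / 2 + 6 * b + 6 * (a / 2) * b) / α) := by
    simp_rw [hu2e]
    rw [integral_div]
    have hN := hU (2 * α) (by linarith)
    rw [LISO.mconst_two_mul hα0, ← div_div a] at hN
    exact LISO.div_sq_le_of_laplace_bounds (LISO.mconst_pos hpd hα0) (by positivity)
      (add_nonneg (hψ0 xs) (by positivity)) (by positivity) hb.le (by linarith) (by linarith) hN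
      (hL α (by linarith))
  obtain ⟨-, hSi, hSle⟩ := hA.integral_sq_norm_sum_le h𝒬 hg₀pos hg hum hui hu2 n
  refine ⟨(LISO.integrable_gibbs_iff hfm α φ).2 hui, ?_⟩
  simp_rw [LISO.integral_gibbs hfm, LISO.estimator_sub_eq f α φ hn, norm_smul, mul_pow]
  refine ⟨hSi.const_mul _, ?_⟩
  rw [integral_const_mul]
  have hn0 : (0 : ℝ) < n := by exact_mod_cast hn
  have e2 : (2 : ℝ) ^ (-(d : ℝ) / 2) = (2 ^ ((d : ℝ) / 2))⁻¹ := by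
    rw [neg_div, Real.rpow_neg (by norm_num)]
  rw [e2]
  calc _ ≤ ‖(n : ℝ)⁻¹‖ ^ 2 * (n * ∫ x, ‖LISO.gibbsWeighted f α φ x‖ ^ 2 / g₀ x) := by gcongr
    _ = (n : ℝ)⁻¹ * ∫ x, ‖LISO.gibbsWeighted f α φ x‖ ^ 2 / g₀ x := by
        rw [Real.norm_eq_abs, sq_abs]; field_simp
    _ ≤ _ := by
        refine (mul_le_mul_of_nonneg_left hI (by positivity)).trans (le_of_eq ?_)
        ring
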